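/- arXiv:1505.03294 — 3 statements merged into one kernel-verified Lean document; each statement's English description precedes it below -/
import Mathlib

section
/- With Δ(k, l, m) the infinite diagonal product of the groups Γ(k_s, l_s, m_s) as above, if the sequence (k_s) is unbounded then ℤ ≀ D₂ (with its standard marked generating set) is a marked quotient of Δ: every word in the three generators representing the identity in Δ also represents the identity in ℤ ≀ D₂. -/
/-- The shift automorphism of the group of `L`-valued functions on `B`. -/
def shiftEquiv {B : Type*} [AddGroup B] {L : Type*} [Group L] (b : B) :
    (B → L) ≃* (B → L) where
  toFun f x := f (x - b)
  invFun f x := f (x + b)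
  left_inv f := by funext x; simp
  right_inv f := by funext x; simp
  map_mul' f g := rfl

/-- The shift action of `B` on `B → L`, as a homomorphism to automorphisms. -/
def shiftHom (B : Type*) [AddCommGroup B] (L : Type*) [Group L] :
    Multiplicative B →* MulAut (B → L) where
  toFun b := shiftEquiv (Multiplicative.toAdd b)
  map_one' := by ext f x; simp [shiftEquiv]
  map_mul' b c := by ext f x; simp [shiftEquiv, sub_sub]

/-- The (unrestricted) wreath product `L ≀ B`, containing the lamplighter group `B ≀ L`
of the paper as the subgroup generated by the marked generators. -/
abbrev Wr (B : Type*) [AddCommGroup B] (L : Type*) [Group L] :=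
  (B → L) ⋊[shiftHom B L] Multiplicative B

/-- The function equal to `v` at `g` and neutral elsewhere. -/
def delta {B : Type*} [DecidableEq B] {L : Type*} [Group L] (g : B) (v : L) : B → L :=
  fun x => if x = g then v else 1

/-- The marked generators `τ = (+1, 𝟙)`, `α = (0, a δ₀)`, `β = (0, b δ_k)` of
`Γ(k, l, m) = (ℤ/mℤ) ≀ D_l` (with `m = 0` meaning `ℤ`, and `l = 0` meaning `D_∞`). -/
def gammaGens (k l m : ℕ) : Fin 3 → Wr (ZMod m) (DihedralGroup l) :=
  ![⟨1, Multiplicative.ofAdd 1⟩,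
    ⟨delta 0 (DihedralGroup.sr 0), 1⟩,
    ⟨delta (k : ZMod m) (DihedralGroup.sr 1), 1⟩]

/-- The diagonal generating triple of the infinite diagonal product
`Δ(k,l,m) ≤ ∏_s Γ(k_s, l_s, m_s)`. -/
def diagGens (k l m : ℕ → ℕ) : Fin 3 → (∀ s, Wr (ZMod (m s)) (DihedralGroup (l s))) :=
  fun i s => gammaGens (k s) (l s) (m s) i

/-- Two integers close to each other with equal residues are equal. -/
lemma cast_inj_of_small (m : ℕ) (a b : ℤ) (h : m = 0 ∨ |b - a| < m) :
    ((a : ZMod m) = (b : ZMod m)) ↔ a = b := by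
  rw [ZMod.intCast_eq_intCast_iff_dvd_sub]
  constructor
  · intro hd
    rcases h with h | h
    · subst h
      have : b - a = 0 := by simpa using hd
      omega
    · have := Int.eq_zero_of_abs_lt_dvd hd h
      omega
  · rintro rfl
    simp

/-- Comparison between an element `G` of `Γ(k,l,m)` and an element `H` of `ℤ ≀ D₂`. -/
def WRel (k l m z N n : ℕ) (G : Wr (ZMod m) (DihedralGroup l))
    (H : Wr (ZMod z) (DihedralGroup 2)) : Prop :=
  ∃ (p : ℤ) (A B : ℤ → ℕ), |p| ≤ n ∧
    G.right = Multiplicative.ofAdd (p : ZMod m) ∧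
    H.right = Multiplicative.ofAdd (p : ZMod z) ∧
    (∀ x : ℤ, |x| ≤ N → G.left (x : ZMod m) = DihedralGroup.sr 0 ^ A x) ∧
    (∀ x : ℤ, |x| ≤ N → G.left ((x + k : ℤ) : ZMod m) = DihedralGroup.sr 1 ^ B x) ∧
    (∀ x : ℤ, H.left (x : ZMod z) = DihedralGroup.sr 0 ^ A x * DihedralGroup.sr 1 ^ B x) ∧
    (∀ x : ℤ, (N : ℤ) < |x| → A x = 0 ∧ B x = 0)

lemma mul_delta_left {m l : ℕ} (G : Wr (ZMod m) (DihedralGroup l)) (p : ℤ) (c : ZMod m)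
    (v : DihedralGroup l) (hp : G.right = Multiplicative.ofAdd (p : ZMod m)) (x : ZMod m) :
    (G * ⟨delta c v, 1⟩).left x = G.left x * (if x = p + c then v else 1) := by
  have h : (G * ⟨delta c v, 1⟩).left x = G.left x * delta c v (x - p) := by
    rw [SemidirectProduct.mul_left, hp]
    rfl
  rw [h, delta]
  simp only [sub_eq_iff_eq_add']

lemma rel_tau {k l m z N n : ℕ} {G H} (e : ℤ) (he : |e| ≤ 1) (h : WRel k l m z N n G H) :
    WRel k l m z N (n + 1) (G * ⟨1, Multiplicative.ofAdd (e : ZMod m)⟩)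
      (H * ⟨1, Multiplicative.ofAdd (e : ZMod z)⟩) := by
  obtain ⟨p, A, B, hp, hG, hH, h1, h2, h3, h4⟩ := h
  refine ⟨p + e, A, B, ?_, ?_, ?_, ?_, ?_, ?_, h4⟩
  · have := abs_add_le p e
    push_cast
    omega
  · simp [hG, ← ofAdd_add]
  · simp [hH, ← ofAdd_add]
  · simpa using h1
  · simpa using h2
  · simpa using h3

lemma rel_alpha {k l m z N n : ℕ} {G H} (hz : z = 0) (hk : 2 * N < k) (hm : m = 0 ∨ 2 * k < m) (hn : n ≤ N)
    (h : WRel k l m z N n G H) :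
    WRel k l m z N (n + 1) (G * gammaGens k l m 1) (H * gammaGens 0 2 z 1) := by
  obtain ⟨p, A, B, hp, hG, hH, h1, h2, h3, h4⟩ := h
  refine ⟨p, Function.update A p (A p + 1), B, ?_, ?_, ?_, ?_, ?_, ?_, ?_⟩
  · push_cast
    omega
  · simp [hG, gammaGens]
  · simp [hH, gammaGens]
  · intro x hx
    have e := mul_delta_left G p 0 (DihedralGroup.sr 0) hG x
    have hc := cast_inj_of_small m x p (by grind)
    simp only [add_zero, hc] at e
    refine e.trans ?_
    rw [h1 x hx]
    by_cases hxp : x = p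
    · subst hxp; simp [pow_succ]
    · simp [hxp]
  · intro x hx
    have e := mul_delta_left G p 0 (DihedralGroup.sr 0) hG ((x + k : ℤ) : ZMod m)
    have hc := cast_inj_of_small m (x + k) p (by grind)
    simp only [add_zero, hc] at e
    refine e.trans ?_
    rw [h2 x hx, if_neg (by grind), mul_one]
  · intro x
    have e := mul_delta_left H p 0 (DihedralGroup.sr 0) hH x
    have hc := cast_inj_of_small z x p (by grind)
    simp only [add_zero, hc] at e
    refine e.trans ?_
    rw [h3 x]
    by_cases hxp : x = p
    · subst hxp
      have cm : Commute (DihedralGroup.sr 1 : DihedralGroup 2) (DihedralGroup.sr 0) := by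
        unfold Commute SemiconjBy; decide
      simp [pow_succ, mul_assoc, (cm.pow_left (B x)).eq]
    · simp [hxp]
  · intro x hx
    have : x ≠ p := by grind
    simp [this, h4 x hx]

lemma rel_beta {k l m z N n : ℕ} {G H} (hz : z = 0) (hk : 2 * N < k) (hm : m = 0 ∨ 2 * k < m) (hn : n ≤ N)
    (h : WRel k l m z N n G H) :
    WRel k l m z N (n + 1) (G * gammaGens k l m 2) (H * gammaGens 0 2 z 2) := by
  obtain ⟨p, A, B, hp, hG, hH, h1, h2, h3, h4⟩ := h
  refine ⟨p, A, Function.update B p (B p + 1), ?_, ?_, ?_, ?_, ?_, ?_, ?_⟩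
  · push_cast
    omega
  · simp [hG, gammaGens]
  · simp [hH, gammaGens]
  · intro x hx
    have e := mul_delta_left G p k (DihedralGroup.sr 1) hG x
    have hc := cast_inj_of_small m x (p + k) (by grind)
    push_cast at hc
    simp only [hc] at e
    refine e.trans ?_
    rw [h1 x hx, if_neg (by grind), mul_one]
  · intro x hx
    have e := mul_delta_left G p k (DihedralGroup.sr 1) hG ((x + k : ℤ) : ZMod m)
    have hc := cast_inj_of_small m (x + k) (p + k) (by grind)
    rw [show (p : ZMod m) + (k : ZMod m) = ((p + k : ℤ) : ZMod m) by push_cast; rfl] at e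
    simp only [hc] at e
    refine e.trans ?_
    rw [h2 x hx]
    by_cases hxp : x = p
    · subst hxp; simp [pow_succ]
    · simp [hxp]
  · intro x
    have e := mul_delta_left H p ((0 : ℕ) : ZMod z) (DihedralGroup.sr 1) hH x
    have hc := cast_inj_of_small z x p (by grind)
    simp only [Nat.cast_zero, add_zero, hc] at e
    refine Eq.trans ?_ (e.trans ?_)
    · simp [gammaGens]
    rw [h3 x]
    by_cases hxp : x = p
    · subst hxp; simp [pow_succ, mul_assoc]
    · simp [hxp]
  · intro x hx
    have : x ≠ p := by grind
    simp [this, h4 x hx]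

lemma delta_inv {m l : ℕ} (c : ZMod m) (i : ZMod l) :
    (⟨delta c (DihedralGroup.sr i), 1⟩ : Wr (ZMod m) (DihedralGroup l))⁻¹ =
      ⟨delta c (DihedralGroup.sr i), 1⟩ := by
  rw [inv_eq_iff_mul_eq_one]
  ext x
  · rw [mul_delta_left _ 0 _ _ (by simp)]
    by_cases h : x = c <;> simp [delta, h]
  · simp

lemma tau_inv (m l : ℕ) :
    (⟨1, Multiplicative.ofAdd 1⟩ : Wr (ZMod m) (DihedralGroup l))⁻¹ =
      ⟨1, Multiplicative.ofAdd ((-1 : ℤ) : ZMod m)⟩ := by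
  rw [inv_eq_iff_mul_eq_one]
  ext x
  · simp
  · simp [← ofAdd_add]

lemma rel_word {k l m z N : ℕ} (hz : z = 0) (hk : 2 * N < k) (hm : m = 0 ∨ 2 * k < m)
    (L : List (Fin 3 × Bool)) (hL : L.length ≤ N) :
    WRel k l m z N L.length (FreeGroup.lift (gammaGens k l m) (FreeGroup.mk L))
      (FreeGroup.lift (gammaGens 0 2 z) (FreeGroup.mk L)) := by
  induction L using List.reverseRecOn with
  | nil =>
    refine ⟨0, fun _ => 0, fun _ => 0, ?_⟩
    simp [← FreeGroup.one_eq_mk]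
  | append_singleton L y ih =>
    rw [List.length_append, List.length_singleton] at hL ⊢
    have ih := ih (by omega)
    rw [← FreeGroup.mul_mk, map_mul, map_mul]
    have key : ∀ (k' l' m' : ℕ), FreeGroup.lift (gammaGens k' l' m') (FreeGroup.mk [y]) =
        cond y.2 (gammaGens k' l' m' y.1) (gammaGens k' l' m' y.1)⁻¹ := by
      intro k' l' m'
      simp [FreeGroup.lift_mk]
    rw [key, key]
    obtain ⟨i, b⟩ := y
    have inv1 : ∀ (k' l' m' : ℕ), (gammaGens k' l' m' 1)⁻¹ = gammaGens k' l' m' 1 :=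
      fun k' l' m' => delta_inv _ _
    have inv2 : ∀ (k' l' m' : ℕ), (gammaGens k' l' m' 2)⁻¹ = gammaGens k' l' m' 2 :=
      fun k' l' m' => delta_inv _ _
    have inv0 : ∀ (k' l' m' : ℕ), (gammaGens k' l' m' 0)⁻¹ =
        ⟨1, Multiplicative.ofAdd ((-1 : ℤ) : ZMod m')⟩ :=
      fun k' l' m' => tau_inv _ _
    have g0 : ∀ (k' l' m' : ℕ), gammaGens k' l' m' 0 =
        ⟨1, Multiplicative.ofAdd ((1 : ℤ) : ZMod m')⟩ := by
      intro k' l' m'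
      simp [gammaGens]
    fin_cases i
    · cases b
      · change WRel _ _ _ _ _ _ (_ * (gammaGens k l m 0)⁻¹) (_ * (gammaGens 0 2 z 0)⁻¹)
        rw [inv0, inv0]
        exact rel_tau (-1) (by simp) ih
      · change WRel _ _ _ _ _ _ (_ * (gammaGens k l m 0)) (_ * (gammaGens 0 2 z 0))
        rw [g0, g0]
        exact rel_tau 1 (by simp) ih
    · cases b
      · change WRel _ _ _ _ _ _ (_ * (gammaGens k l m 1)⁻¹) (_ * (gammaGens 0 2 z 1)⁻¹)
        rw [inv1, inv1]
        exact rel_alpha hz hk hm (by omega) ih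
      · exact rel_alpha hz hk hm (by omega) ih
    · cases b
      · change WRel _ _ _ _ _ _ (_ * (gammaGens k l m 2)⁻¹) (_ * (gammaGens 0 2 z 2)⁻¹)
        rw [inv2, inv2]
        exact rel_beta hz hk hm (by omega) ih
      · exact rel_beta hz hk hm (by omega) ih

lemma sr_pow_transfer {l : ℕ} (i : ZMod l) (j : ZMod 2) (n : ℕ)
    (h : (DihedralGroup.sr i : DihedralGroup l) ^ n = 1) :
    (DihedralGroup.sr j : DihedralGroup 2) ^ n = 1 := by
  have := orderOf_dvd_of_pow_eq_one h
  rw [DihedralGroup.orderOf_sr] at this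
  apply orderOf_dvd_iff_pow_eq_one.mp
  rwa [DihedralGroup.orderOf_sr]

lemma rel_one {k l m z N n : ℕ} {H} (hz : z = 0) (hk : 2 * N < k) (hm : m = 0 ∨ 2 * k < m) (hn : n ≤ N)
    (h : WRel k l m z N n 1 H) : H = 1 := by
  obtain ⟨p, A, B, hp, hG, hH, h1, h2, h3, h4⟩ := h
  have hG' : ((0 : ℤ) : ZMod m) = (p : ZMod m) := by
    have := congrArg Multiplicative.toAdd hG
    simpa using this
  have hp0 := (cast_inj_of_small m 0 p (by grind)).1 hG'
  subst hp0
  ext x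
  · obtain ⟨x, rfl⟩ := ZMod.intCast_surjective x
    rw [h3]
    by_cases hx : |x| ≤ N
    · have a1 := h1 x hx
      have a2 := h2 x hx
      simp only [SemidirectProduct.one_left, Pi.one_apply] at a1 a2
      rw [sr_pow_transfer _ _ _ a1.symm, sr_pow_transfer _ _ _ a2.symm]
      simp
    · obtain ⟨ha, hb⟩ := h4 x (by omega)
      simp [ha, hb]
  · simp [hH]

/-- If the sequence `(k_s)` is unbounded, then `ℤ ≀ D₂` (with its standard marked
generating set) is a marked quotient of the infinite diagonal product `Δ(k,l,m)`:
every word representing the identity in `Δ` also represents the identity in `ℤ ≀ D₂`. -/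
theorem stmt12 (k l m : ℕ → ℕ) (hl : ∀ s, l s = 0 ∨ 2 ≤ l s)
    (hm : ∀ s, m s = 0 ∨ 2 * k s < m s) (hk : ∀ N : ℕ, ∃ s, N ≤ k s)
    (w : FreeGroup (Fin 3)) (hw : FreeGroup.lift (diagGens k l m) w = 1) :
    FreeGroup.lift (gammaGens 0 2 0) w = 1 := by
  obtain ⟨s, hs⟩ := hk (2 * w.toWord.length + 1)
  have hr := rel_word (z := 0) (l := l s) (N := w.toWord.length) rfl (by omega) (hm s) w.toWord le_rfl
  rw [FreeGroup.mk_toWord] at hr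
  have hhom : (Pi.evalMonoidHom _ s).comp (FreeGroup.lift (diagGens k l m)) =
      FreeGroup.lift (gammaGens (k s) (l s) (m s)) := by
    ext1 i
    simp [diagGens]
  have h1 : FreeGroup.lift (gammaGens (k s) (l s) (m s)) w = 1 := by
    rw [← hhom, MonoidHom.comp_apply, hw, map_one]
  rw [h1] at hr
  exact rel_one rfl (by omega) (hm s) le_rfl hr
end

section
/- There exists a universal constant C > 0 (independent of k, l, n) such that for the switch-walk-switch random walks Z_n^{l} on ℤ ≀ D_l and Z_n^{2l} on ℤ ≀ D_{2l} (both with shift parameter k), one has E|Z_n^{l}| ≤ E|Z_n^{2l}| ≤ C · E|Z_n^{l}| for all n. -/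
/-- Word length of `g` with respect to a set `S` of generators. -/
noncomputable def lengthWrt {G : Type*} [Group G] (S : Set G) (g : G) : ℕ :=
  sInf {n | ∃ L : List G, (∀ x ∈ L, x ∈ S) ∧ L.length = n ∧ L.prod = g}

/-- The power `g^ε` for `ε ∈ {0,1}`. -/
def pw {G : Type*} [Group G] (g : G) (b : Bool) : G := if b then g else 1

/-- The generator `τ = (+1, 𝟙)` of `ℤ ≀ D_l`. -/
def tauG (l : ℕ) : Wr ℤ (DihedralGroup l) := ⟨1, Multiplicative.ofAdd 1⟩

/-- The generator `α = (0, a δ₀)` of `ℤ ≀ D_l`. -/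
def alphaG (l : ℕ) : Wr ℤ (DihedralGroup l) := ⟨delta 0 (DihedralGroup.sr 0), 1⟩

/-- The generator `β = (0, b δ_k)` of `ℤ ≀ D_l`. -/
def betaG (k l : ℕ) : Wr ℤ (DihedralGroup l) := ⟨delta (k : ℤ) (DihedralGroup.sr 1), 1⟩

/-- The set of switches `u ∈ {α^ε β^ε', β^ε α^ε'}`. -/
def swsU (k l : ℕ) : Set (Wr ℤ (DihedralGroup l)) :=
  {u | ∃ ε ε' : Bool,
    u = pw (alphaG l) ε * pw (betaG k l) ε' ∨ u = pw (betaG k l) ε * pw (alphaG l) ε'}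

/-- The switch-walk-switch generating set: all `u₁ τ^{±1} u₂` with `u_i` switches. -/
def swsSet (k l : ℕ) : Set (Wr ℤ (DihedralGroup l)) :=
  {g | ∃ u₁ ∈ swsU k l, ∃ u₂ ∈ swsU k l,
    g = u₁ * tauG l * u₂ ∨ g = u₁ * (tauG l)⁻¹ * u₂}

/-- The generators `a = sr 0`, `b = sr 1` of the dihedral group. -/
def dihGens (l : ℕ) : Set (DihedralGroup l) := {DihedralGroup.sr 0, DihedralGroup.sr 1}

/-- The sample space for one switch-walk-switch step: the two switches `u₁, u₂`
(each given by two independent uniform bits) and the move `η = ±1` (one bit). -/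
abbrev Step := (Bool × Bool) × Bool × (Bool × Bool)

/-- The group element `u₁ τ^{η} u₂ = α^{ε₁}β^{ε₂} · τ^{±1} · α^{ε₃}β^{ε₄}`
determined by a sample point. -/
def stepElt (k l : ℕ) (s : Step) : Wr ℤ (DihedralGroup l) :=
  pw (alphaG l) s.1.1 * pw (betaG k l) s.1.2 *
    (tauG l) ^ (if s.2.1 then (1 : ℤ) else -1) *
    pw (alphaG l) s.2.2.1 * pw (betaG k l) s.2.2.2

/-- The expected switch-walk-switch word length `E|Z_n|` of the switch-walk-switch
random walk on `ℤ ≀ D_l` (shift parameter `k`) at time `n`: the average over all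
(uniform, independent) sample points of the word length of the product of the steps. -/
noncomputable def walkE (k l n : ℕ) : ℝ :=
  (∑ ω : Fin n → Step, (lengthWrt (swsSet k l)
      (((List.finRange n).map (fun j => stepElt k l (ω j))).prod) : ℝ)) /
    (Fintype.card (Fin n → Step) : ℝ)

namespace S17

/-! ### Dihedral elements indexed by integers -/

def letter (L : ℕ) (c : Bool) : DihedralGroup L :=
  if c then DihedralGroup.sr 0 else DihedralGroup.sr 1

def elt (L : ℕ) (v : ℤ) : DihedralGroup L :=
  if v % 2 = 0 then DihedralGroup.r ((v / 2 : ℤ) : ZMod L)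
  else DihedralGroup.sr (((1 - v) / 2 : ℤ) : ZMod L)

theorem elt_even (L : ℕ) (i : ℤ) : elt L (2 * i) = DihedralGroup.r (i : ZMod L) := by
  have h : (2 * i) / 2 = i := by omega
  simp [elt, h]

theorem elt_odd (L : ℕ) (i : ℤ) : elt L (1 - 2 * i) = DihedralGroup.sr (i : ZMod L) := by
  have h : (1 - (1 - 2 * i)) / 2 = i := by omega
  have h2 : (1 - 2 * i) % 2 ≠ 0 := by omega
  rw [elt, if_neg h2, h]

theorem elt_zero (L : ℕ) : elt L 0 = 1 := by
  have := elt_even L 0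
  simpa using this

theorem par (v : ℤ) : (∃ i, v = 2 * i) ∨ ∃ i, v = 1 - 2 * i := by
  rcases Int.emod_two_eq_zero_or_one v with h | h
  · exact Or.inl ⟨v / 2, by omega⟩
  · exact Or.inr ⟨(1 - v) / 2, by omega⟩

theorem letter_mul_elt (L : ℕ) (c : Bool) (v : ℤ) :
    letter L c * elt L v = elt L ((if c then 1 else -1) - v) := by
  rcases par v with ⟨i, rfl⟩ | ⟨i, rfl⟩ <;> cases c
  · have : ((if false = true then (1 : ℤ) else -1) - 2 * i) = 1 - 2 * (1 + i) := by simp; ring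
    rw [this, elt_even, elt_odd]; simp [letter]
  · have : ((if true = true then (1 : ℤ) else -1) - 2 * i) = 1 - 2 * i := by simp
    rw [this, elt_even, elt_odd]; simp [letter]
  · have : ((if false = true then (1 : ℤ) else -1) - (1 - 2 * i)) = 2 * (i - 1) := by simp; ring
    rw [this, elt_even, elt_odd]; simp [letter]
  · have : ((if true = true then (1 : ℤ) else -1) - (1 - 2 * i)) = 2 * i := by simp
    rw [this, elt_even, elt_odd]; simp [letter]

def mv (c : Bool) (v : ℤ) : ℤ := if (v % 2 = 0 ↔ c = true) then v + 1 else v - 1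

theorem elt_mul_letter (L : ℕ) (c : Bool) (v : ℤ) :
    elt L v * letter L c = elt L (mv c v) := by
  rcases par v with ⟨i, rfl⟩ | ⟨i, rfl⟩ <;> cases c
  · have : mv false (2 * i) = 1 - 2 * (1 - i) := by simp [mv]; ring
    rw [this, elt_even, elt_odd]; simp [letter]
  · have : mv true (2 * i) = 1 - 2 * (- i) := by simp [mv]; ring
    rw [this, elt_even, elt_odd]; simp [letter]
  · have h2 : (1 - 2 * i) % 2 ≠ 0 := by omega
    have : mv false (1 - 2 * i) = 2 * (1 - i) := by simp [mv]; ring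
    rw [this, elt_even, elt_odd]; simp [letter]
  · have h2 : (1 - 2 * i) % 2 ≠ 0 := by omega
    have : mv true (1 - 2 * i) = 2 * (- i) := by simp [mv]
    rw [this, elt_even, elt_odd]; simp [letter]

theorem elt_eq_iff (L : ℕ) (v w : ℤ) : elt L v = elt L w ↔ (2 * L : ℤ) ∣ v - w := by
  rcases par v with ⟨i, rfl⟩ | ⟨i, rfl⟩ <;> rcases par w with ⟨j, rfl⟩ | ⟨j, rfl⟩
  · rw [elt_even, elt_even, DihedralGroup.r.injEq, eq_comm, ZMod.intCast_eq_intCast_iff_dvd_sub,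
      ← mul_sub, mul_dvd_mul_iff_left (by norm_num)]
  · rw [elt_even, elt_odd]
    constructor
    · intro h; cases h
    · rintro ⟨t, ht⟩; rw [mul_assoc] at ht; omega
  · rw [elt_even, elt_odd]
    constructor
    · intro h; cases h
    · rintro ⟨t, ht⟩; rw [mul_assoc] at ht; omega
  · rw [elt_odd, elt_odd, DihedralGroup.sr.injEq, ZMod.intCast_eq_intCast_iff_dvd_sub]
    rw [show 1 - 2 * i - (1 - 2 * j) = 2 * (j - i) by ring, mul_dvd_mul_iff_left (by norm_num)]

/-! ### Words -/

def evw (L : ℕ) (w : List Bool) : DihedralGroup L := (w.map (letter L)).prod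

theorem evw_nil (L : ℕ) : evw L [] = 1 := rfl
theorem evw_cons (L : ℕ) (c : Bool) (w : List Bool) : evw L (c :: w) = letter L c * evw L w := by
  simp [evw]
theorem evw_append (L : ℕ) (w w' : List Bool) : evw L (w ++ w') = evw L w * evw L w' := by
  simp [evw]

/-- Alternating word of length `n` starting with `c`. -/
def aw : Bool → ℕ → List Bool
  | _, 0 => []
  | c, n + 1 => c :: aw (!c) n

def awz (v : ℤ) : List Bool := aw (decide (0 ≤ v)) v.natAbs

theorem evw_aw (L : ℕ) (c : Bool) (n : ℕ) :
    evw L (aw c n) = elt L (if c then (n : ℤ) else -n) := by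
  induction n generalizing c with
  | zero => simp [aw, evw_nil, elt_zero]
  | succ n ih =>
    rw [aw, evw_cons, ih, letter_mul_elt]
    congr 1
    cases c <;> simp <;> ring

theorem evw_awz (L : ℕ) (v : ℤ) : evw L (awz v) = elt L v := by
  rw [awz, evw_aw]
  congr 1
  by_cases h : 0 ≤ v
  · simp only [h, decide_true, if_true]; omega
  · simp only [h, decide_false]; simp only [Bool.false_eq_true, if_false]; omega

theorem awz_nonneg (n : ℕ) : awz (n : ℤ) = aw true n := by simp [awz]
theorem awz_nonpos (n : ℕ) : awz (-(n : ℤ)) = aw false n := by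
  rcases n with _ | n
  · simp [awz, aw]
  · have : ¬ (0 ≤ (-((n + 1 : ℕ) : ℤ))) := by omega
    rw [awz, decide_eq_false this, Int.natAbs_neg, Int.natAbs_natCast]

theorem int_cases (v : ℤ) : (∃ n : ℕ, v = -(n : ℤ)) ∨ ∃ n : ℕ, v = ((n + 1 : ℕ) : ℤ) := by
  rcases le_or_gt v 0 with h | h
  · exact Or.inl ⟨v.natAbs, by omega⟩
  · exact Or.inr ⟨v.natAbs - 1, by omega⟩

theorem reduce (w : List Bool) : ∃ v : ℤ, (awz v).Sublist w ∧ ∀ L, evw L w = elt L v := by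
  induction w with
  | nil => exact ⟨0, by simp [awz, aw], fun L => by rw [evw_nil, elt_zero]⟩
  | cons c w ih =>
    obtain ⟨v, hs, he⟩ := ih
    refine ⟨(if c then 1 else -1) - v, ?_, fun L => by rw [evw_cons, he, letter_mul_elt]⟩
    cases c
    · rcases int_cases (-v) with ⟨n, hn⟩ | ⟨n, hn⟩
      · obtain rfl : v = n := by omega
        rw [show ((if false = true then (1 : ℤ) else -1) - n) = -((n + 1 : ℕ) : ℤ) by simp; ring,
          awz_nonpos]
        rw [awz_nonneg] at hs
        exact List.Sublist.cons_cons _ hs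
      · obtain rfl : v = -((n + 1 : ℕ) : ℤ) := by omega
        rw [show ((if false = true then (1 : ℤ) else -1) - (-((n + 1 : ℕ) : ℤ))) = (n : ℤ) by
          simp, awz_nonneg]
        rw [awz_nonpos] at hs
        exact ((List.sublist_cons_self _ _).trans hs).trans (List.sublist_cons_self _ _)
    · rcases int_cases v with ⟨n, rfl⟩ | ⟨n, rfl⟩
      · rw [show ((if true = true then (1 : ℤ) else -1) - -(n : ℤ)) = ((n + 1 : ℕ) : ℤ) by
          simp; ring, awz_nonneg]
        rw [awz_nonpos] at hs
        exact List.Sublist.cons_cons _ hs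
      · rw [show ((if true = true then (1 : ℤ) else -1) - ((n + 1 : ℕ) : ℤ)) = -(n : ℤ) by
          simp, awz_nonpos]
        rw [awz_nonneg] at hs
        exact ((List.sublist_cons_self _ _).trans hs).trans (List.sublist_cons_self _ _)

theorem aw_le (c : Bool) {i j : ℕ} (h : i ≤ j) : (aw c i).Sublist (aw c j) := by
  induction i generalizing c j with
  | zero => simp [aw]
  | succ i ih =>
    obtain ⟨j, rfl⟩ : ∃ j', j = j' + 1 := ⟨j - 1, by omega⟩
    exact List.Sublist.cons_cons _ (ih _ (by omega))

theorem aw_lt (c d : Bool) {i j : ℕ} (h : i < j) : (aw c i).Sublist (aw d j) := by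
  by_cases hcd : c = d
  · subst hcd; exact aw_le _ h.le
  · obtain rfl : c = !d := by cases c <;> cases d <;> simp_all
    obtain ⟨j, rfl⟩ : ∃ j', j = j' + 1 := ⟨j - 1, by omega⟩
    exact (aw_le _ (by omega)).trans (List.sublist_cons_self _ _)

def Both (M : List Bool) (i : ℕ) : Prop := ∀ c, (aw c i).Sublist M

theorem Both.of_awz {M : List Bool} {v : ℤ} {i : ℕ} (h : (awz v).Sublist M) (hi : i < v.natAbs) :
    Both M i := fun _ => (aw_lt _ _ hi).trans h

theorem Both.awz {M : List Bool} {v : ℤ} {i : ℕ} (h : Both M i) (hi : v.natAbs ≤ i) :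
    (awz v).Sublist M := (aw_le _ hi).trans (h _)

theorem Both.mono {M M' : List Bool} {i : ℕ} (h : Both M i) (hs : M.Sublist M') : Both M' i :=
  fun c => (h c).trans hs

theorem aw_add (c : Bool) (i j : ℕ) : ∃ d, aw c (i + j) = aw c i ++ aw d j := by
  induction i generalizing c with
  | zero => exact ⟨c, by simp [aw]⟩
  | succ i ih =>
    obtain ⟨d, hd⟩ := ih (!c)
    exact ⟨d, by rw [show i + 1 + j = (i + j) + 1 by omega]; simp [aw, hd]⟩

theorem Both.append {M M' : List Bool} {i j : ℕ} (h : Both M i) (h' : Both M' j) :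
    Both (M ++ M') (i + j) := by
  intro c
  obtain ⟨d, hd⟩ := aw_add c i j
  rw [hd]
  exact (h c).append (h' d)

theorem aw_rev (c : Bool) (i : ℕ) : ∃ d, aw c i = (aw d i).reverse := by
  have key : ∀ i c, aw c (i + 1) = aw c i ++ [if i % 2 = 0 then c else !c] := by
    intro i
    induction i with
    | zero => intro c; simp [aw]
    | succ i ih =>
      intro c
      rw [aw, ih (!c), aw]
      have : (if i % 2 = 0 then !c else !!c) = if (i + 1) % 2 = 0 then c else !c := by
        rcases Nat.mod_two_eq_zero_or_one i with h | h
        · have h' : (i + 1) % 2 = 1 := by omega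
          simp [h, h']
        · have h' : (i + 1) % 2 = 0 := by omega
          simp [h, h']
      simp only [List.cons_append, this]
  induction i generalizing c with
  | zero => exact ⟨c, by simp [aw]⟩
  | succ i ih =>
    obtain ⟨d, hd⟩ := ih c
    rw [key, hd]
    rcases i with _ | i
    · exact ⟨c, by simp [aw]⟩
    · refine ⟨!d, ?_⟩
      have hx : aw (!d) (i + 1 + 1) = (!d) :: aw d (i + 1) := by
        rw [aw, Bool.not_not]
      rw [hx, List.reverse_cons]
      congr 2
      have h1 : (aw c (i + 1)).getLast? = some (if i % 2 = 0 then c else !c) := by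
        rw [key]; simp
      have h2 : (aw c (i + 1)).getLast? = some d := by
        rw [hd, aw]; simp
      rw [h1] at h2
      have h3 := Option.some.inj h2
      rw [← h3]
      rcases Nat.mod_two_eq_zero_or_one i with h | h
      · have h' : (i + 1) % 2 = 1 := by omega
        simp [h, h']
      · have h' : (i + 1) % 2 = 0 := by omega
        simp [h, h']

theorem Both.reverse {M : List Bool} {i : ℕ} (h : Both M i) : Both M.reverse i := by
  intro c
  obtain ⟨d, hd⟩ := aw_rev c i
  rw [hd]
  exact (h d).reverse

/-! ### Plans -/

def pt (η : Bool) : ℤ := if η then 1 else -1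

def mA (y : ℤ) : List Bool := if y = 0 then [true] else []
def mB (k : ℕ) (y : ℤ) : List Bool := if y = k then [false] else []
def mo (k : ℕ) (o : Bool) (y : ℤ) : List Bool :=
  if o then mA y ++ mB k y else mB k y ++ mA y

abbrev Plan := List (Bool × Bool × Bool)

def M (k : ℕ) : Plan → ℤ → List Bool
  | [], _ => []
  | (o, η, o') :: p, y => mo k o y ++ (mo k o' (y - pt η) ++ M k p (y - pt η))

def tp : Plan → ℤ
  | [] => 0
  | (_, η, _) :: p => pt η + tp p

theorem tp_append (p q : Plan) : tp (p ++ q) = tp p + tp q := by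
  induction p with
  | nil => simp [tp]
  | cons a p ih => obtain ⟨o, η, o'⟩ := a; simp [tp, ih, add_assoc]

theorem M_append (k : ℕ) (p q : Plan) (y : ℤ) : M k (p ++ q) y = M k p y ++ M k q (y - tp p) := by
  induction p generalizing y with
  | nil => simp [tp, M]
  | cons a p ih => obtain ⟨o, η, o'⟩ := a; simp [tp, M, ih, sub_sub]

def rv : Plan → Plan
  | [] => []
  | (o, η, o') :: p => rv p ++ [(!o', !η, !o)]

theorem rv_length (p : Plan) : (rv p).length = p.length := by
  induction p with
  | nil => rfl
  | cons a p ih => obtain ⟨o, η, o'⟩ := a; simp [rv, ih]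

theorem pt_not (η : Bool) : pt (!η) = - pt η := by cases η <;> simp [pt]

theorem rv_tp (p : Plan) : tp (rv p) = - tp p := by
  induction p with
  | nil => rfl
  | cons a p ih => obtain ⟨o, η, o'⟩ := a; simp [rv, tp_append, ih, tp, pt_not]

theorem mo_rev (k : ℕ) (o : Bool) (y : ℤ) : mo k (!o) y = (mo k o y).reverse := by
  cases o <;> simp only [mo, mA, mB] <;> split_ifs <;> simp_all

theorem rv_M (k : ℕ) (p : Plan) (y : ℤ) : M k (rv p) y = (M k p (y + tp p)).reverse := by
  induction p generalizing y with
  | nil => rfl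
  | cons a p ih =>
    obtain ⟨o, η, o'⟩ := a
    simp only [rv, M_append, ih, M, tp, mo_rev, rv_tp, pt_not, List.reverse_append,
      List.append_nil, List.append_assoc]
    congr 3 <;> ring_nf

theorem tp_le (p : Plan) : (tp p).natAbs ≤ p.length := by
  induction p with
  | nil => simp [tp]
  | cons a p ih =>
    obtain ⟨o, η, o'⟩ := a
    cases η <;> simp [tp, pt] <;> omega

end S17
namespace S17

theorem mul_def' {L : ℕ} (f g : ℤ → DihedralGroup L) (x t : ℤ) :
    ((⟨f, Multiplicative.ofAdd x⟩ : Wr ℤ (DihedralGroup L)) * ⟨g, Multiplicative.ofAdd t⟩) =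
      ⟨fun y => f y * g (y - x), Multiplicative.ofAdd (x + t)⟩ := by
  rfl

theorem one_def' {L : ℕ} : (1 : Wr ℤ (DihedralGroup L)) = ⟨fun _ => 1, Multiplicative.ofAdd 0⟩ :=
  rfl

theorem pw_alpha (L : ℕ) (ε : Bool) : pw (alphaG L) ε =
    ⟨fun y => evw L (if ε then mA y else []), Multiplicative.ofAdd 0⟩ := by
  cases ε
  · rfl
  · simp only [pw, if_true, alphaG]
    congr 1
    funext y
    simp only [delta, mA]
    split_ifs <;> simp [evw, letter]

theorem pw_beta (k L : ℕ) (ε : Bool) : pw (betaG k L) ε =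
    ⟨fun y => evw L (if ε then mB k y else []), Multiplicative.ofAdd 0⟩ := by
  cases ε
  · rfl
  · simp only [pw, if_true, betaG]
    congr 1
    funext y
    simp only [delta, mB]
    split_ifs <;> simp [evw, letter]

theorem tau_pow (L : ℕ) (η : Bool) : (tauG L) ^ (pt η) =
    ⟨fun _ => 1, Multiplicative.ofAdd (pt η)⟩ := by
  cases η
  · rw [pt, if_neg (by simp), zpow_neg_one]
    apply inv_eq_of_mul_eq_one_right
    rw [tauG]
    refine (mul_def' _ _ _ _).trans ?_
    simp only [Pi.one_apply, mul_one]
    rfl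
  · simp [pt, tauG]; rfl

theorem swsU_imp (k L : ℕ) (u : Wr ℤ (DihedralGroup L)) (hu : u ∈ swsU k L) :
    ∃ o f, u = ⟨f, Multiplicative.ofAdd 0⟩ ∧ ∀ y, ∃ w, w.Sublist (mo k o y) ∧ evw L w = f y := by
  have hs : ∀ (ε : Bool) (l : List Bool), (if ε then l else []).Sublist l := by
    intro ε l; cases ε <;> simp
  obtain ⟨ε, ε', h | h⟩ := hu
  · rw [pw_alpha, pw_beta, mul_def'] at h
    refine ⟨true, _, h, fun y => ⟨(if ε then mA y else []) ++ (if ε' then mB k y else []), ?_, ?_⟩⟩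
    · exact (hs _ _).append (hs _ _)
    · rw [evw_append, sub_zero]
  · rw [pw_alpha, pw_beta, mul_def'] at h
    refine ⟨false, _, h, fun y => ⟨(if ε then mB k y else []) ++ (if ε' then mA y else []), ?_, ?_⟩⟩
    · exact (hs _ _).append (hs _ _)
    · rw [evw_append, sub_zero]

theorem choice_A (w : ℤ → List Bool) (h : ∀ y, (w y).Sublist (mA y)) :
    ∃ ε : Bool, ∀ y, w y = if ε then mA y else [] := by
  refine ⟨decide (w 0 ≠ []), fun y => ?_⟩
  by_cases hy : y = 0
  · subst hy
    have := h 0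
    simp only [mA, if_true] at this ⊢
    rcases List.sublist_singleton.1 this with h | h <;> simp [h]
  · have := h y
    simp only [mA, hy, if_false] at this ⊢
    simpa using this

theorem choice_B (k : ℕ) (w : ℤ → List Bool) (h : ∀ y, (w y).Sublist (mB k y)) :
    ∃ ε : Bool, ∀ y, w y = if ε then mB k y else [] := by
  refine ⟨decide (w k ≠ []), fun y => ?_⟩
  by_cases hy : y = k
  · subst hy
    have := h k
    simp only [mB, if_true] at this ⊢
    rcases List.sublist_singleton.1 this with h | h <;> simp [h]
  · have := h y
    simp only [mB, hy, if_false] at this ⊢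
    simpa using this

theorem imp_swsU (k L : ℕ) (o : Bool) (w : ℤ → List Bool) (h : ∀ y, (w y).Sublist (mo k o y)) :
    (⟨fun y => evw L (w y), Multiplicative.ofAdd 0⟩ : Wr ℤ (DihedralGroup L)) ∈ swsU k L := by
  cases o
  · have : ∀ y, ∃ w1 w2, w y = w1 ++ w2 ∧ w1.Sublist (mB k y) ∧ w2.Sublist (mA y) := fun y =>
      List.sublist_append_iff.1 (by simpa [mo] using h y)
    choose w1 w2 he h1 h2 using this
    obtain ⟨ε, hε⟩ := choice_B k w1 h1
    obtain ⟨ε', hε'⟩ := choice_A w2 h2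
    refine ⟨ε, ε', Or.inr ?_⟩
    rw [pw_alpha, pw_beta, mul_def']
    simp only [he, evw_append, hε, hε', sub_zero, add_zero]
  · have : ∀ y, ∃ w1 w2, w y = w1 ++ w2 ∧ w1.Sublist (mA y) ∧ w2.Sublist (mB k y) := fun y =>
      List.sublist_append_iff.1 (by simpa [mo] using h y)
    choose w1 w2 he h1 h2 using this
    obtain ⟨ε, hε⟩ := choice_A w1 h1
    obtain ⟨ε', hε'⟩ := choice_B k w2 h2
    refine ⟨ε, ε', Or.inl ?_⟩
    rw [pw_alpha, pw_beta, mul_def']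
    simp only [he, evw_append, hε, hε', sub_zero, add_zero]

theorem plan_of_list (k L : ℕ) (l : List (Wr ℤ (DihedralGroup L))) (hl : ∀ x ∈ l, x ∈ swsSet k L) :
    ∃ p : Plan, p.length = l.length ∧ ∃ f, l.prod = ⟨f, Multiplicative.ofAdd (tp p)⟩ ∧
      ∀ y, ∃ w, w.Sublist (M k p y) ∧ evw L w = f y := by
  induction l with
  | nil => exact ⟨[], rfl, _, rfl, fun y => ⟨[], by simp, rfl⟩⟩
  | cons g l ih =>
    obtain ⟨p, hp, f, hf, hw⟩ := ih (fun x hx => hl x (by simp [hx]))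
    obtain ⟨u₁, hu₁, u₂, hu₂, hg⟩ := hl g (by simp)
    have hg' : ∃ η, g = u₁ * (tauG L) ^ (pt η) * u₂ := by
      rcases hg with h | h
      · exact ⟨true, by simpa [pt] using h⟩
      · exact ⟨false, by simpa [pt] using h⟩
    obtain ⟨η, hη⟩ := hg'
    obtain ⟨o₁, f₁, rfl, h₁⟩ := swsU_imp k L u₁ hu₁
    obtain ⟨o₂, f₂, rfl, h₂⟩ := swsU_imp k L u₂ hu₂
    refine ⟨(o₁, η, o₂) :: p, by simp [hp], fun y => f₁ y * (f₂ (y - pt η) * f (y - pt η)), ?_, ?_⟩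
    · rw [List.prod_cons, hη, hf, tau_pow, mul_def', mul_def', mul_def']
      simp only [tp, zero_add, add_zero, mul_one, mul_assoc]
    · intro y
      obtain ⟨w₁, hs₁, he₁⟩ := h₁ y
      obtain ⟨w₂, hs₂, he₂⟩ := h₂ (y - pt η)
      obtain ⟨w₃, hs₃, he₃⟩ := hw (y - pt η)
      exact ⟨w₁ ++ (w₂ ++ w₃), hs₁.append (hs₂.append hs₃), by
        rw [evw_append, evw_append, he₁, he₂, he₃]⟩

theorem list_of_plan (k L : ℕ) (p : Plan) (w : ℤ → List Bool) (h : ∀ y, (w y).Sublist (M k p y)) :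
    ∃ l : List (Wr ℤ (DihedralGroup L)), (∀ x ∈ l, x ∈ swsSet k L) ∧ l.length = p.length ∧
      l.prod = ⟨fun y => evw L (w y), Multiplicative.ofAdd (tp p)⟩ := by
  induction p generalizing w with
  | nil =>
    refine ⟨[], by simp, rfl, ?_⟩
    have : w = fun _ => [] := by
      funext y; simpa [M] using h y
    subst this
    rfl
  | cons a p ih =>
    obtain ⟨o, η, o'⟩ := a
    have : ∀ y, ∃ w1 w2 w3, w y = w1 ++ (w2 ++ w3) ∧ w1.Sublist (mo k o y) ∧
        w2.Sublist (mo k o' (y - pt η)) ∧ w3.Sublist (M k p (y - pt η)) := by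
      intro y
      obtain ⟨w1, w', e, s1, s'⟩ := List.sublist_append_iff.1 (h y)
      obtain ⟨w2, w3, e', s2, s3⟩ := List.sublist_append_iff.1 s'
      exact ⟨w1, w2, w3, by rw [e, e'], s1, s2, s3⟩
    choose w1 w2 w3 he h1 h2 h3 using this
    obtain ⟨l, hl, hlen, hprod⟩ := ih (fun y => w3 (y + pt η)) (fun y => by
      simpa using h3 (y + pt η))
    refine ⟨(⟨fun y => evw L (w1 y), Multiplicative.ofAdd 0⟩ * (tauG L) ^ (pt η) *
      ⟨fun y => evw L (w2 (y + pt η)), Multiplicative.ofAdd 0⟩) :: l, ?_, by simp [hlen], ?_⟩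
    · intro x hx
      rcases List.mem_cons.1 hx with rfl | hx
      · refine ⟨_, imp_swsU k L o w1 h1, _, imp_swsU k L o' (fun y => w2 (y + pt η)) (fun y => by
          simpa using h2 (y + pt η)), ?_⟩
        cases η
        · right; simp [pt]
        · left; simp [pt]
      · exact hl x hx
    · rw [List.prod_cons, hprod, tau_pow, mul_def', mul_def', mul_def']
      simp only [tp, zero_add, add_zero, mul_one, mul_assoc, he, evw_append,
        sub_add_cancel]

/-! ### States -/

abbrev St := (ℤ → ℤ) × ℤ

def ev (L : ℕ) (s : St) : Wr ℤ (DihedralGroup L) :=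
  ⟨fun y => elt L (s.1 y), Multiplicative.ofAdd s.2⟩

/-- Reachability: word-length-relevant description. -/
theorem len_le (k L : ℕ) (s : St) (p : Plan) (ht : tp p = s.2)
    (h : ∀ y, ∃ u, (awz u).Sublist (M k p y) ∧ elt L u = elt L (s.1 y)) :
    lengthWrt (swsSet k L) (ev L s) ≤ p.length := by
  choose u hu he using h
  obtain ⟨l, hl, hlen, hprod⟩ := list_of_plan k L p (fun y => awz (u y)) hu
  apply Nat.sInf_le
  refine ⟨l, hl, hlen, ?_⟩
  rw [hprod, ev, ht]
  simp only [evw_awz, he]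

def Reachable (k L : ℕ) (s : St) : Prop :=
  ∃ l : List (Wr ℤ (DihedralGroup L)), (∀ x ∈ l, x ∈ swsSet k L) ∧ l.prod = ev L s

theorem len_plan (k L : ℕ) (s : St) (hr : Reachable k L s) :
    ∃ p : Plan, p.length = lengthWrt (swsSet k L) (ev L s) ∧ tp p = s.2 ∧
      ∀ y, ∃ u, (awz u).Sublist (M k p y) ∧ elt L u = elt L (s.1 y) := by
  have hne : {n | ∃ l : List (Wr ℤ (DihedralGroup L)), (∀ x ∈ l, x ∈ swsSet k L) ∧
      l.length = n ∧ l.prod = ev L s}.Nonempty := by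
    obtain ⟨l, h1, h2⟩ := hr
    exact ⟨_, l, h1, rfl, h2⟩
  obtain ⟨l, h1, h2, h3⟩ := Nat.sInf_mem hne
  obtain ⟨p, hp, f, hf, hw⟩ := plan_of_list k L l h1
  rw [h3, ev] at hf
  have hl := congrArg SemidirectProduct.left hf
  have hrr := congrArg SemidirectProduct.right hf
  refine ⟨p, by rw [hp, h2]; rfl, (Multiplicative.ofAdd.injective hrr).symm, fun y => ?_⟩
  obtain ⟨w, hs, he⟩ := hw y
  obtain ⟨v, hv, hve⟩ := reduce w
  refine ⟨v, hv.trans hs, ?_⟩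
  rw [← hve, he]
  exact (congrFun hl y).symm

theorem len_mono (k l : ℕ) (s : St) (hr : Reachable k (2 * l) s) :
    lengthWrt (swsSet k l) (ev l s) ≤ lengthWrt (swsSet k (2 * l)) (ev (2 * l) s) := by
  obtain ⟨p, hp, ht, h⟩ := len_plan k _ s hr
  rw [← hp]
  refine len_le k l s p ht (fun y => ?_)
  obtain ⟨u, hu, he⟩ := h y
  refine ⟨u, hu, ?_⟩
  rw [elt_eq_iff] at he ⊢
  refine dvd_trans ?_ he
  exact ⟨2, by push_cast; ring⟩

/-! ### Machine -/

def opL (c : Bool) (d : ℤ) (s : St) (b : Bool) : St :=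
  if b then (Function.update s.1 (s.2 + d) (mv c (s.1 (s.2 + d))), s.2) else s

def opT (s : St) (b : Bool) : St := (s.1, s.2 + pt b)

theorem ev_opL (L : ℕ) (c : Bool) (d : ℤ) (s : St) (b : Bool) :
    ev L (opL c d s b) = ev L s *
      pw (⟨delta d (letter L c), 1⟩ : Wr ℤ (DihedralGroup L)) b := by
  cases b
  · simp [opL, pw]
  · simp only [opL, if_true, pw, ev]
    refine Eq.trans ?_ (mul_def' _ _ _ 0).symm
    rw [add_zero]
    congr 1
    funext y
    by_cases hy : y = s.2 + d
    · subst hy; simp [delta, elt_mul_letter]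
    · have : y - s.2 ≠ d := fun h => hy (by omega)
      simp [delta, hy, this]

theorem ev_opT (L : ℕ) (s : St) (b : Bool) :
    ev L (opT s b) = ev L s * (tauG L) ^ (if b then (1 : ℤ) else -1) := by
  have := tau_pow L b
  rw [pt] at this
  rw [this, ev, ev, mul_def', opT]
  simp only [pt, mul_one]

def comp {A B : Type} (f : St → A → St) (g : St → B → St) (s : St) (a : A × B) : St :=
  g (f s a.1) a.2

def opU (k : ℕ) : St → Bool × Bool → St := comp (opL true 0) (opL false k)

def stepS (k : ℕ) : St → Step → St := comp (opU k) (comp opT (opU k))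

theorem ev_stepS (k L : ℕ) (s : St) (a : Step) :
    ev L (stepS k s a) = ev L s * stepElt k L a := by
  simp only [stepS, opU, comp, ev_opL, ev_opT, stepElt, mul_assoc]
  rfl

def run (k : ℕ) : (n : ℕ) → St → (Fin n → Step) → St
  | 0, s, _ => s
  | n + 1, s, ω => run k n (stepS k s (ω 0)) (Fin.tail ω)

theorem ev_run (k L n : ℕ) (s : St) (ω : Fin n → Step) :
    ev L (run k n s ω) = ev L s * ((List.finRange n).map (fun j => stepElt k L (ω j))).prod := by
  induction n generalizing s with
  | zero => simp [run]
  | succ n ih =>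
    rw [run, ih, ev_stepS, List.finRange_succ]
    simp [mul_assoc, Function.comp_def, Fin.tail]

def s0 : St := (fun _ => 0, 0)

theorem ev_s0 (L : ℕ) : ev L s0 = 1 := by
  simp only [ev, s0, elt_zero]; rfl

theorem ev_run0 (k L n : ℕ) (ω : Fin n → Step) :
    ((List.finRange n).map (fun j => stepElt k L (ω j))).prod = ev L (run k n s0 ω) := by
  rw [ev_run, ev_s0, one_mul]

theorem stepElt_mem (k L : ℕ) (a : Step) : stepElt k L a ∈ swsSet k L := by
  refine ⟨_, ⟨a.1.1, a.1.2, Or.inl rfl⟩, _, ⟨a.2.2.1, a.2.2.2, Or.inl rfl⟩, ?_⟩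
  rcases a with ⟨a, η, b⟩
  cases η
  · right; simp [stepElt, mul_assoc]
  · left; simp [stepElt, mul_assoc]

theorem reach_run (k L n : ℕ) (ω : Fin n → Step) : Reachable k L (run k n s0 ω) := by
  refine ⟨_, ?_, ev_run0 k L n ω⟩
  intro x hx
  obtain ⟨j, _, rfl⟩ := List.mem_map.1 hx
  exact stepElt_mem k L _

noncomputable def len (k L : ℕ) (s : St) : ℕ := lengthWrt (swsSet k L) (ev L s)

theorem walkE_eq (k L n : ℕ) : walkE k L n =
    (∑ ω : Fin n → Step, (len k L (run k n s0 ω) : ℝ)) / (Fintype.card (Fin n → Step) : ℝ) := by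
  simp only [walkE, ev_run0, len]

end S17
namespace S17

/-! ### Couplings -/

abbrev Rel := St → St → St → Prop

def Cpl (R R' : Rel) {A : Type} (f : St → A → St) : Prop :=
  ∀ s s' s'', R s s' s'' → ∃ e e' : A ≃ A, ∀ a, R' (f s a) (f s' (e a)) (f s'' (e' a))

theorem Cpl.comp {R R' R'' : Rel} {A B : Type} {f : St → A → St} {g : St → B → St}
    (hf : Cpl R R' f) (hg : Cpl R' R'' g) : Cpl R R'' (comp f g) := by
  intro s s' s'' h
  obtain ⟨e, e', he⟩ := hf s s' s'' h
  choose e₂ e₂' he₂ using fun a => hg _ _ _ (he a)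
  exact ⟨Equiv.prodShear e e₂, Equiv.prodShear e' e₂', fun a => he₂ a.1 a.2⟩

theorem Cpl.run_succ {R R' : Rel} {k n : ℕ} (hf : Cpl R R' (stepS k)) (hg : Cpl R' R' (run k n)) :
    Cpl R R' (run k (n + 1)) := by
  intro s s' s'' h
  obtain ⟨e, e', he⟩ := hf s s' s'' h
  choose e₂ e₂' he₂ using fun a => hg _ _ _ (he a)
  let c := Fin.consEquiv (fun _ : Fin (n + 1) => Step)
  refine ⟨(c.symm.trans (Equiv.prodShear e e₂)).trans c,
    (c.symm.trans (Equiv.prodShear e' e₂')).trans c, fun a => ?_⟩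
  exact he₂ (a 0) (Fin.tail a)

theorem Cpl.run {R : Rel} {k : ℕ} (hf : Cpl R R (stepS k)) (n : ℕ) : Cpl R R (run k n) := by
  induction n with
  | zero => intro s s' s'' h; exact ⟨Equiv.refl _, Equiv.refl _, fun _ => h⟩
  | succ n ih => exact hf.run_succ ih

theorem opL_pos (c : Bool) (d : ℤ) (s : St) (b : Bool) : (opL c d s b).2 = s.2 := by
  cases b <;> simp [opL]

theorem opL_ne (c : Bool) (d : ℤ) (s : St) (b : Bool) (y : ℤ) (h : y ≠ s.2 + d) :
    (opL c d s b).1 y = s.1 y := by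
  cases b <;> simp [opL, h]

theorem opL_eq (c : Bool) (d : ℤ) (s : St) (b : Bool) :
    (opL c d s b).1 (s.2 + d) = if b then mv c (s.1 (s.2 + d)) else s.1 (s.2 + d) := by
  cases b <;> simp [opL]

/-! ### Reflection coupling -/

def Q (m v v' : ℤ) : Prop :=
  (v = v' ∧ |v| ≤ m) ∨ v' = 2 * m + 1 - v ∨ v' = -(2 * m + 1) - v

theorem mv_odd (c : Bool) (j v : ℤ) : mv c (2 * j + 1 - v) = 2 * j + 1 - mv c v := by
  cases c <;> simp only [mv] <;> split_ifs <;> simp_all <;> omega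

theorem mv_mv (c : Bool) (v : ℤ) : mv c (mv c v) = v := by
  cases c <;> simp only [mv] <;> split_ifs <;> simp_all <;> omega

theorem mv_cases (c : Bool) (v : ℤ) : mv c v = v + 1 ∨ mv c v = v - 1 := by
  unfold mv; split_ifs <;> simp

theorem Q_mv {m v v' : ℤ} (c : Bool) (h : Q m v v') : ∃ e : Bool ≃ Bool, ∀ b : Bool,
    Q m (if b then mv c v else v) (if e b then mv c v' else v') := by
  rcases h with ⟨rfl, hm⟩ | h | h
  · rw [abs_le] at hm
    by_cases hn : |mv c v| ≤ m
    · refine ⟨Equiv.refl _, fun b => Or.inl ?_⟩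
      cases b <;> simp [hn, abs_le, hm]
    · refine ⟨Equiv.boolNot, fun b => Or.inr ?_⟩
      rw [abs_le] at hn
      cases b <;> simp <;> rcases mv_cases c v with h | h <;> omega
  · refine ⟨Equiv.refl _, fun b => Or.inr (Or.inl ?_)⟩
    cases b
    · simpa using h
    · simp [h, mv_odd]
  · refine ⟨Equiv.refl _, fun b => Or.inr (Or.inr ?_)⟩
    cases b
    · simpa using h
    · have := mv_odd c (-m - 1) v
      rw [show 2 * (-m - 1) + 1 - v = -(2 * m + 1) - v by ring] at this
      simp only [h, if_true, Equiv.refl_apply, this]; ring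

def RB (m : ℤ) : Rel := fun s s' _ => s.2 = s'.2 ∧ ∀ y, Q m (s.1 y) (s'.1 y)

theorem RB_opL (m : ℤ) (c : Bool) (d : ℤ) : Cpl (RB m) (RB m) (opL c d) := by
  rintro s s' s'' ⟨hx, hQ⟩
  obtain ⟨e, he⟩ := Q_mv c (hQ (s.2 + d))
  refine ⟨e, Equiv.refl _, fun b => ⟨by rw [opL_pos, opL_pos, hx], fun y => ?_⟩⟩
  by_cases hy : y = s.2 + d
  · have h2 : y = s'.2 + d := by rw [hy, hx]
    have h1 := he b
    rw [← opL_eq, ← hy] at h1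
    rw [hy, hx, ← opL_eq, ← h2] at h1
    exact h1
  · rw [opL_ne _ _ _ _ _ hy, opL_ne _ _ _ _ _ (by rwa [← hx])]
    exact hQ y

theorem RB_opT (m : ℤ) : Cpl (RB m) (RB m) opT := by
  rintro s s' s'' ⟨hx, hQ⟩
  exact ⟨Equiv.refl _, Equiv.refl _, fun b => ⟨by simp [opT, hx], hQ⟩⟩

theorem RB_step (m : ℤ) (k : ℕ) : Cpl (RB m) (RB m) (stepS k) :=
  ((RB_opL m _ _).comp (RB_opL m _ _)).comp
    ((RB_opT m).comp ((RB_opL m _ _).comp (RB_opL m _ _)))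

/-! ### Maximum coupling -/

def dd (x : ℤ) : ℤ := if 0 ≤ x then x else -x - 1

def inr (A B y : ℤ) : Prop := -A ≤ y ∧ y ≤ B

def Sup (k : ℕ) (A B y v : ℤ) : Prop :=
  (inr A B y ∧ inr A B (y - k)) ∨ (inr A B y ∧ (v = 0 ∨ v = 1)) ∨
    (inr A B (y - k) ∧ (v = 0 ∨ v = -1)) ∨ v = 0

def RS (k : ℕ) (q : ℤ) : Rel := fun s s' s'' => ∃ A B : ℤ, 0 ≤ A ∧ 0 ≤ B ∧ q ≤ A + B ∧
  B = s.2 + dd s'.2 ∧ A = -s.2 + dd s''.2 ∧ ∀ y, Sup k A B y (s.1 y)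

theorem dd_nonneg (x : ℤ) : 0 ≤ dd x := by unfold dd; split_ifs <;> omega

theorem RS_opL (k : ℕ) (q : ℤ) (c : Bool) : Cpl (RS k q) (RS k q) (opL c (if c then 0 else k)) := by
  rintro s s' s'' ⟨A, B, hA, hB, hq, h1, h2, h3⟩
  refine ⟨Equiv.refl _, Equiv.refl _, fun b => ⟨A, B, hA, hB, hq, ?_, ?_, fun y => ?_⟩⟩
  · simpa only [opL_pos] using h1
  · simpa only [opL_pos] using h2
  · have hd1 := dd_nonneg s'.2
    have hd2 := dd_nonneg s''.2
    by_cases hy : y = s.2 + (if c then 0 else (k : ℤ))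
    · have h3y := h3 y
      rw [hy] at h3y ⊢
      rw [opL_eq]
      cases b
      · simpa using h3y
      · simp only [if_true]
        have e0 : mv true 0 = 1 := by decide
        have e1 : mv true 1 = 0 := by decide
        have e2 : mv false 0 = -1 := by decide
        have e3 : mv false (-1) = 0 := by decide
        cases c
        · simp only [Bool.false_eq_true, if_false] at h3y ⊢
          have hin : inr A B (s.2 + k - k) := ⟨by omega, by omega⟩
          rcases h3y with h | ⟨h, _⟩ | ⟨h, h' | h'⟩ | h
          · exact Or.inl h
          · exact Or.inl ⟨h, hin⟩
          · rw [h', e2]; exact Or.inr (Or.inr (Or.inl ⟨hin, Or.inr rfl⟩))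
          · rw [h', e3]; exact Or.inr (Or.inr (Or.inl ⟨hin, Or.inl rfl⟩))
          · rw [h, e2]; exact Or.inr (Or.inr (Or.inl ⟨hin, Or.inr rfl⟩))
        · simp only [if_true] at h3y ⊢
          have hin : inr A B (s.2 + 0) := ⟨by omega, by omega⟩
          rcases h3y with h | ⟨h, h' | h'⟩ | ⟨h, _⟩ | h
          · exact Or.inl h
          · rw [h', e0]; exact Or.inr (Or.inl ⟨hin, Or.inr rfl⟩)
          · rw [h', e1]; exact Or.inr (Or.inl ⟨hin, Or.inl rfl⟩)
          · exact Or.inl ⟨hin, h⟩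
          · rw [h, e0]; exact Or.inr (Or.inl ⟨hin, Or.inr rfl⟩)
    · rw [opL_ne _ _ _ _ _ hy]; exact h3 y

theorem Sup_mono {k : ℕ} {A B A' B' y v : ℤ} (hA : A ≤ A') (hB : B ≤ B') (h : Sup k A B y v) :
    Sup k A' B' y v := by
  have : ∀ z, inr A B z → inr A' B' z := fun z hz => ⟨by have := hz.1; omega, by
    have := hz.2; omega⟩
  rcases h with ⟨h, h'⟩ | ⟨h, h'⟩ | ⟨h, h'⟩ | h
  · exact Or.inl ⟨this _ h, this _ h'⟩
  · exact Or.inr (Or.inl ⟨this _ h, h'⟩)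
  · exact Or.inr (Or.inr (Or.inl ⟨this _ h, h'⟩))
  · exact Or.inr (Or.inr (Or.inr h))

theorem dd_step (x' : ℤ) : ∃ e : Bool ≃ Bool, ∀ b : Bool,
    dd x' ≤ pt b + dd (x' + pt (e b)) := by
  by_cases h : 0 ≤ x'
  · refine ⟨Equiv.boolNot, fun b => ?_⟩
    cases b <;> simp [pt, dd] <;> split_ifs <;> omega
  · refine ⟨Equiv.refl _, fun b => ?_⟩
    cases b <;> simp [pt, dd] <;> split_ifs <;> omega

theorem RS_opT (k : ℕ) (q : ℤ) : Cpl (RS k q) (RS k (max q 1)) opT := by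
  rintro s s' s'' ⟨A, B, hA, hB, hq, h1, h2, h3⟩
  obtain ⟨e, he⟩ := dd_step s'.2
  obtain ⟨e', he'⟩ := dd_step s''.2
  refine ⟨e, Equiv.boolNot.trans e', fun b => ?_⟩
  have hb := he b
  have hb' := he' (!b)
  have d1 := dd_nonneg s'.2
  have d2 := dd_nonneg s''.2
  have d3 := dd_nonneg (s'.2 + pt (e b))
  have d4 := dd_nonneg (s''.2 + pt (e' !b))
  have hp : pt b = 1 ∨ pt b = -1 := by cases b <;> simp [pt]
  rw [pt_not] at hb'
  have a1 : B ≤ s.2 + pt b + dd (s'.2 + pt (e b)) := by omega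
  have a2 : A ≤ -(s.2 + pt b) + dd (s''.2 + pt (e' !b)) := by omega
  refine ⟨-(s.2 + pt b) + dd (s''.2 + pt (e' !b)), s.2 + pt b + dd (s'.2 + pt (e b)), ?_, ?_, ?_,
    rfl, rfl, fun y => Sup_mono a2 a1 (h3 y)⟩ <;> omega

theorem RS_opU (k : ℕ) (q : ℤ) : Cpl (RS k q) (RS k q) (opU k) :=
  (RS_opL k q true).comp (RS_opL k q false)

theorem RS_step (k : ℕ) (q : ℤ) : Cpl (RS k q) (RS k (max q 1)) (stepS k) :=
  (RS_opU k q).comp ((RS_opT k q).comp (RS_opU k _))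

theorem RS_run (k n : ℕ) : Cpl (RS k 0) (RS k 1) (run k (n + 1)) := by
  have h0 := RS_step k 0
  have h1 := RS_step k 1
  rw [max_eq_right (by norm_num)] at h0 h1
  exact h0.run_succ (h1.run n)

end S17
namespace S17

/-! ### Combining plans -/

def rep (q : Plan) : ℕ → Plan
  | 0 => []
  | n + 1 => q ++ rep q n

theorem rep_length (q : Plan) (n : ℕ) : (rep q n).length = n * q.length := by
  induction n with
  | zero => simp [rep]
  | succ n ih => simp [rep, ih]; ring

theorem rep_tp (q : Plan) (h : tp q = 0) (n : ℕ) : tp (rep q n) = 0 := by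
  induction n with
  | zero => simp [rep, tp]
  | succ n ih => simp [rep, ih, tp_append, h]

theorem rep_both (k : ℕ) (q : Plan) (h : tp q = 0) (y : ℤ) (i n : ℕ) (hb : Both (M k q y) i) :
    Both (M k (rep q n) y) (n * i) := by
  induction n with
  | zero => intro c; simp [aw]
  | succ n ih =>
    rw [rep, M_append, h, sub_zero, show (n + 1) * i = i + n * i by ring]
    exact hb.append ih

def pal (p : Plan) : Plan := p ++ rv p

theorem pal_tp (p : Plan) : tp (pal p) = 0 := by simp [pal, tp_append, rv_tp]

theorem pal_both (k : ℕ) (p : Plan) (y : ℤ) (i : ℕ) (hb : Both (M k p y) i) :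
    Both (M k (pal p) y) (2 * i) := by
  rw [pal, M_append, rv_M, sub_add_cancel, two_mul]
  exact hb.append hb.reverse

theorem repr_elt (L : ℕ) (hL : 1 ≤ L) (v : ℤ) : ∃ u : ℤ, u.natAbs ≤ L ∧ elt L u = elt L v := by
  have hpos : (0 : ℤ) < 2 * L := by omega
  have h1 := Int.emod_nonneg (v + L) hpos.ne'
  have h2 := Int.emod_lt_of_pos (v + L) hpos
  refine ⟨(v + L) % (2 * L) - L, by omega, ?_⟩
  rw [elt_eq_iff]
  refine ⟨-((v + L) / (2 * L)), ?_⟩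
  have := Int.emod_add_mul_ediv (v + L) (2 * L)
  linarith

theorem fact1 {l : ℕ} {m u v : ℤ} {W : List Bool} (hm : 2 * m < 2 * l) (hv : |v| ≤ m)
    (hu : (awz u).Sublist W) (he : elt l u = elt l v) : (awz v).Sublist W := by
  by_cases huv : u = v
  · rwa [← huv]
  · rw [elt_eq_iff] at he
    rw [abs_le] at hv
    have : v.natAbs < u.natAbs := by
      by_contra hcon
      apply huv
      have h0 := Int.eq_zero_of_abs_lt_dvd he (by rw [abs_lt]; constructor <;> omega)
      omega
    exact (Both.of_awz hu this).awz le_rfl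

theorem fact2 {l : ℕ} {m u u' v v' : ℤ} (hm : 2 * m + 1 ≤ l)
    (hv : v' = 2 * m + 1 - v ∨ v' = -(2 * m + 1) - v)
    (he : elt l u = elt l v) (he' : elt l u' = elt l v') :
    2 * m + 1 ≤ |u| + |u'| := by
  rw [elt_eq_iff] at he he'
  have hd := dvd_add he he'
  by_contra hcon
  have h1 := abs_add_le u u'
  have h2 : |u + u'| < 2 * m + 1 := by omega
  rw [abs_lt] at h2
  rcases hv with h | h
  · rw [show u - v + (u' - v') = u + u' - (2 * m + 1) by rw [h]; ring] at hd
    have h0 := Int.eq_zero_of_abs_lt_dvd hd (by rw [abs_lt]; constructor <;> omega)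
    omega
  · rw [show u - v + (u' - v') = u + u' + (2 * m + 1) by rw [h]; ring] at hd
    have h0 := Int.eq_zero_of_abs_lt_dvd hd (by rw [abs_lt]; constructor <;> omega)
    omega

theorem big_bound (k l : ℕ) (hl : 3 ≤ l) (s s' s'' : St) (hR : RB (((l - 1) / 2 : ℕ) : ℤ) s s' s'')
    (hr : Reachable k l s) (hr' : Reachable k l s') :
    len k (2 * l) s ≤ 13 * len k l s + 12 * len k l s' := by
  obtain ⟨p, hp, ht, hu⟩ := len_plan k l s hr
  obtain ⟨p', hp', -, hu'⟩ := len_plan k l s' hr'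
  obtain ⟨-, hQ⟩ := hR
  set m : ℤ := (((l - 1) / 2 : ℕ) : ℤ) with hmdef
  have hlen : (rep (pal p) 6 ++ (rep (pal p') 6 ++ p)).length =
      13 * len k l s + 12 * len k l s' := by
    simp only [List.length_append, rep_length, pal, rv_length, len, hp, hp']; ring
  rw [← hlen]
  refine len_le k _ s _ ?_ (fun y => ?_)
  · simp [tp_append, rep_tp _ (pal_tp _), ht]
  · have hM : M k (rep (pal p) 6 ++ (rep (pal p') 6 ++ p)) y =
        M k (rep (pal p) 6) y ++ (M k (rep (pal p') 6) y ++ M k p y) := by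
      simp [M_append, rep_tp _ (pal_tp _)]
    rw [hM]
    obtain ⟨u, hus, hue⟩ := hu y
    obtain ⟨u', hus', hue'⟩ := hu' y
    rcases hQ y with ⟨-, hv⟩ | hv
    · refine ⟨s.1 y, ?_, rfl⟩
      have := fact1 (l := l) (by omega) hv hus hue
      exact (this.trans (List.sublist_append_right _ _)).trans (List.sublist_append_right _ _)
    · have h2 := fact2 (l := l) (by omega) hv hue hue'
      obtain ⟨w, hw, hwe⟩ := repr_elt (2 * l) (by omega) (s.1 y)
      refine ⟨w, ?_, hwe⟩
      rw [Int.abs_eq_natAbs, Int.abs_eq_natAbs] at h2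
      rcases le_total u.natAbs u'.natAbs with hle | hle
      · have hb : Both (M k p' y) (u'.natAbs - 1) := Both.of_awz hus' (by omega)
        have hb2 := rep_both k _ (pal_tp _) y _ 6 (pal_both k p' y _ hb)
        have := hb2.awz (v := w) (by omega)
        exact (this.trans (List.sublist_append_left _ _)).trans (List.sublist_append_right _ _)
      · have hb : Both (M k p y) (u.natAbs - 1) := Both.of_awz hus (by omega)
        have hb2 := rep_both k _ (pal_tp _) y _ 6 (pal_both k p y _ hb)
        have := hb2.awz (v := w) (by omega)
        exact this.trans (List.sublist_append_left _ _)

/-! ### Sweeps -/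

def str (η : Bool) (n : ℕ) : Plan := List.replicate n (true, η, true)

theorem str_tp (η : Bool) (n : ℕ) : tp (str η n) = n * pt η := by
  induction n with
  | zero => simp [str, tp]
  | succ n ih =>
    rw [str, List.replicate_succ, tp, ← str, ih]; push_cast; ring

theorem str_visit (k : ℕ) (η : Bool) (n i : ℕ) (hn : 1 ≤ n) (hi : i ≤ n) (y : ℤ) :
    (mo k true (y - i * pt η)).Sublist (M k (str η n) y) := by
  induction n generalizing i y with
  | zero => omega
  | succ n ih =>
    rw [str, List.replicate_succ, M, ← str]
    rcases i with _ | _ | i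
    · simp
    · simp only [zero_add, Nat.cast_one, one_mul]
      exact (List.sublist_append_left _ _).trans (List.sublist_append_right _ _)
    · have := ih (i + 1) (by omega) (by omega) (y - pt η)
      rw [show y - pt η - ((i + 1 : ℕ) : ℤ) * pt η = y - ((i + 1 + 1 : ℕ) : ℤ) * pt η by
        push_cast; ring] at this
      exact (this.trans (List.sublist_append_right _ _)).trans (List.sublist_append_right _ _)

def sweep (A B : ℕ) : Plan := str true B ++ (str false (A + B) ++ str true A)

theorem sweep_tp (A B : ℕ) : tp (sweep A B) = 0 := by
  simp [sweep, tp_append, str_tp, pt]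

theorem sweep_length (A B : ℕ) : (sweep A B).length = 2 * (A + B) := by
  simp [sweep, str]; ring

theorem sweep_visit (k A B : ℕ) (h : 1 ≤ A + B) (y z : ℤ) (hz : inr A B z) :
    (mo k true (y - z)).Sublist (M k (sweep A B) y) := by
  obtain ⟨h1, h2⟩ := hz
  rw [sweep, M_append, M_append]
  have := str_visit k false (A + B) ((B : ℤ) - z).natAbs h (by omega) (y - tp (str true B))
  have e : y - tp (str true B) - (((B : ℤ) - z).natAbs : ℤ) * pt false = y - z := by
    rw [str_tp, Int.natAbs_of_nonneg (by omega)]; simp [pt]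
  rw [e] at this
  exact (this.trans (List.sublist_append_left _ _)).trans (List.sublist_append_right _ _)

theorem sub_true (k : ℕ) : [true].Sublist (mo k true 0) := by
  simp [mo, mA]

theorem sub_false (k : ℕ) : [false].Sublist (mo k true k) := by
  simp [mo, mB]

theorem small_bound (k l : ℕ) (hl : 1 ≤ l) (hl2 : l ≤ 2) (s s' s'' : St) (hR : RS k 1 s s' s'')
    (hr' : Reachable k l s') (hr'' : Reachable k l s'') :
    len k (2 * l) s ≤ 9 * len k l s' + 9 * len k l s'' := by
  obtain ⟨p', hp', ht', -⟩ := len_plan k l s' hr'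
  obtain ⟨p'', hp'', ht'', -⟩ := len_plan k l s'' hr''
  have hl' := tp_le p'
  have hl'' := tp_le p''
  rw [ht', hp', ← len] at hl'
  rw [ht'', hp'', ← len] at hl''
  obtain ⟨A, B, hA, hB, hq, h1, h2, h3⟩ := hR
  lift A to ℕ using hA
  lift B to ℕ using hB
  have d1 := dd_nonneg s'.2
  have d2 := dd_nonneg s''.2
  have d1' : dd s'.2 ≤ s'.2.natAbs := by unfold dd; split_ifs <;> omega
  have d2' : dd s''.2 ≤ s''.2.natAbs := by unfold dd; split_ifs <;> omega
  let t : Plan := str (decide (0 ≤ s.2)) s.2.natAbs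
  have htt : tp t = s.2 := by
    simp only [t, str_tp]
    by_cases h : 0 ≤ s.2
    · simp [h, pt]
    · simp only [h, decide_false, pt, Bool.false_eq_true, if_false]; omega
  have htl : t.length = s.2.natAbs := by simp [t, str]
  have hle : (rep (sweep A B) 4 ++ t).length ≤ 9 * len k l s' + 9 * len k l s'' := by
    rw [List.length_append, rep_length, sweep_length, htl]; omega
  refine le_trans (len_le k _ s _ ?_ (fun y => ?_)) hle
  · simp [tp_append, rep_tp _ (sweep_tp _ _), htt]
  · have hM : ∀ W : List Bool, W.Sublist (M k (rep (sweep A B) 4) y) →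
        W.Sublist (M k (rep (sweep A B) 4 ++ t) y) := fun W hW => by
      rw [M_append]; exact hW.trans (List.sublist_append_left _ _)
    have hM1 : ∀ W : List Bool, W.Sublist (M k (sweep A B) y) →
        W.Sublist (M k (rep (sweep A B) 4 ++ t) y) := fun W hW => hM W (by
      rw [rep, M_append]; exact hW.trans (List.sublist_append_left _ _))
    have hAB : 1 ≤ A + B := by omega
    have vt : inr A B y → [true].Sublist (M k (sweep A B) y) := fun h => by
      have := sweep_visit k A B hAB y y h
      rw [sub_self] at this
      exact (sub_true k).trans this
    have vf : inr A B (y - k) → [false].Sublist (M k (sweep A B) y) := fun h => by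
      have := sweep_visit k A B hAB y (y - k) h
      rw [sub_sub_cancel] at this
      exact (sub_false k).trans this
    have hz : (awz 0).Sublist (M k (rep (sweep A B) 4 ++ t) y) := by simp [awz, aw]
    rcases h3 y with ⟨ha, hb⟩ | ⟨ha, h | h⟩ | ⟨ha, h | h⟩ | h
    · obtain ⟨w, hw, hwe⟩ := repr_elt (2 * l) (by omega) (s.1 y)
      refine ⟨w, hM _ ?_, hwe⟩
      have hb : Both (M k (sweep A B) y) 1 := by
        intro c
        cases c
        · simpa [aw] using vf hb
        · simpa [aw] using vt ha
      exact (rep_both k _ (sweep_tp _ _) y _ 4 hb).awz (by omega)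
    · exact ⟨0, hz, by rw [h]⟩
    · exact ⟨1, hM1 _ (by simpa [awz, aw] using vt ha), by rw [h]⟩
    · exact ⟨0, hz, by rw [h]⟩
    · exact ⟨-1, hM1 _ (by simpa [awz, aw] using vf ha), by rw [h]⟩
    · exact ⟨0, hz, by rw [h]⟩

theorem coupling (k l n : ℕ) (hl : 1 ≤ l) : ∃ e e' : (Fin n → Step) ≃ (Fin n → Step),
    ∀ ω, len k (2 * l) (run k n s0 ω) ≤ 13 * len k l (run k n s0 ω) +
      12 * len k l (run k n s0 (e ω)) + 12 * len k l (run k n s0 (e' ω)) := by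
  by_cases h3 : 3 ≤ l
  · have h0 : RB (((l - 1) / 2 : ℕ) : ℤ) s0 s0 s0 := ⟨rfl, fun y => Or.inl ⟨rfl, by simp only [s0, abs_zero]; omega⟩⟩
    obtain ⟨e, e', he⟩ := (RB_step _ k).run n _ _ _ h0
    refine ⟨e, e', fun ω => ?_⟩
    have := big_bound k l h3 _ _ _ (he ω) (reach_run _ _ _ _) (reach_run _ _ _ _)
    omega
  · rcases n with _ | n
    · refine ⟨Equiv.refl _, Equiv.refl _, fun ω => ?_⟩
      have : len k (2 * l) (run k 0 s0 ω) ≤ 0 :=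
        len_le k _ _ [] rfl (fun y => ⟨0, by simp [awz, aw], rfl⟩)
      omega
    · have h0 : RS k 0 s0 s0 s0 :=
        ⟨0, 0, le_rfl, le_rfl, le_rfl, by simp [s0, dd], by simp [s0, dd],
          fun y => Or.inr (Or.inr (Or.inr rfl))⟩
      obtain ⟨e, e', he⟩ := RS_run k n _ _ _ h0
      refine ⟨e, e', fun ω => ?_⟩
      have := small_bound k l hl (by omega) _ _ _ (he ω) (reach_run _ _ _ _) (reach_run _ _ _ _)
      omega

theorem main (k l n : ℕ) (hl : 1 ≤ l) :
    walkE k l n ≤ walkE k (2 * l) n ∧ walkE k (2 * l) n ≤ 37 * walkE k l n := by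
  rw [walkE_eq, walkE_eq]
  constructor
  · gcongr with ω
    exact len_mono k l _ (reach_run _ _ _ _)
  · obtain ⟨e, e', he⟩ := coupling k l n hl
    rw [← mul_div_assoc]
    gcongr
    calc (∑ ω : Fin n → Step, (len k (2 * l) (run k n s0 ω) : ℝ))
        ≤ ∑ ω : Fin n → Step, (13 * (len k l (run k n s0 ω) : ℝ) +
          12 * (len k l (run k n s0 (e ω)) : ℝ) + 12 * (len k l (run k n s0 (e' ω)) : ℝ)) := by
          apply Finset.sum_le_sum
          intro ω _
          exact_mod_cast he ω
      _ = 37 * ∑ ω : Fin n → Step, (len k l (run k n s0 ω) : ℝ) := by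
          rw [Finset.sum_add_distrib, Finset.sum_add_distrib, ← Finset.mul_sum, ← Finset.mul_sum,
            ← Finset.mul_sum, Equiv.sum_comp e (fun ω => (len k l (run k n s0 ω) : ℝ)),
            Equiv.sum_comp e' (fun ω => (len k l (run k n s0 ω) : ℝ))]
          ring

end S17

/-- There is a universal constant `C > 0`, independent of `k`, `l`, `n`, with
`E|Z_n^l| ≤ E|Z_n^{2l}| ≤ C · E|Z_n^l|` for the switch-walk-switch random walks
on `ℤ ≀ D_l` and `ℤ ≀ D_{2l}` (same shift parameter `k`). -/
theorem stmt17 : ∃ C : ℝ, 0 < C ∧ ∀ k l n : ℕ, 1 ≤ l →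
    walkE k l n ≤ walkE k (2 * l) n ∧ walkE k (2 * l) n ≤ C * walkE k l n := by
  exact ⟨37, by norm_num, fun k l n hl => S17.main k l n hl⟩
end

section
/- For the switch-walk-switch random walk on ℤ ≀ D_∞ (infinite dihedral lamps, shift parameter k), there exist constants c₁, c₂ > 0 depending only on k such that c₁ n^{3/4} ≤ E|Z_n| ≤ c₂ n^{3/4} for all n ≥ 1. -/
namespace Pf

/-- Average of `F` over all lists of length `n`. -/
noncomputable def Av (α : Type) [Fintype α] : ℕ → (List α → ℝ) → ℝ
  | 0, F => F []
  | n + 1, F => (∑ s : α, Av α n (fun l => F (s :: l))) / (Fintype.card α : ℝ)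

section av
variable {α : Type} [Fintype α]

lemma Av_mono (n : ℕ) : ∀ (F G : List α → ℝ), (∀ l, l.length = n → F l ≤ G l) →
    Av α n F ≤ Av α n G := by
  induction n with
  | zero => intro F G h; exact h [] rfl
  | succ n ih =>
    intro F G h
    simp only [Av]
    gcongr with s
    exact ih _ _ (fun l hl => h _ (by simp [hl]))

lemma Av_congr (n : ℕ) (F G : List α → ℝ) (h : ∀ l, l.length = n → F l = G l) :
    Av α n F = Av α n G :=
  le_antisymm (Av_mono n _ _ fun l hl => (h l hl).le) (Av_mono n _ _ fun l hl => (h l hl).ge)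

lemma Av_add (n : ℕ) : ∀ (F G : List α → ℝ),
    Av α n (fun l => F l + G l) = Av α n F + Av α n G := by
  induction n with
  | zero => intro F G; rfl
  | succ n ih =>
    intro F G
    simp only [Av, ih, Finset.sum_add_distrib, add_div]

lemma Av_mul (n : ℕ) (c : ℝ) : ∀ (F : List α → ℝ),
    Av α n (fun l => c * F l) = c * Av α n F := by
  induction n with
  | zero => intro F; rfl
  | succ n ih =>
    intro F
    simp only [Av, ih, ← Finset.mul_sum, mul_div_assoc]

lemma Av_const [Nonempty α] (n : ℕ) (c : ℝ) : Av α n (fun _ => c) = c := by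
  induction n with
  | zero => rfl
  | succ n ih =>
    simp only [Av, ih]
    have : (Fintype.card α : ℝ) ≠ 0 := by exact_mod_cast Fintype.card_ne_zero
    simp

lemma Av_sum {ι : Type} (n : ℕ) (S : Finset ι) (F : ι → List α → ℝ) :
    Av α n (fun l => ∑ i ∈ S, F i l) = ∑ i ∈ S, Av α n (F i) := by
  classical
  induction S using Finset.induction_on with
  | empty =>
    simp only [Finset.sum_empty]
    simpa using Av_mul n 0 (fun _ : List α => (0 : ℝ))
  | insert a S ha ih =>
    simp only [Finset.sum_insert ha, Av_add, ih]

lemma Av_append (m n : ℕ) : ∀ (F : List α → ℝ),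
    Av α (m + n) F = Av α m (fun l => Av α n (fun l' => F (l ++ l'))) := by
  induction m with
  | zero => intro F; simp [Av]
  | succ m ih =>
    intro F
    rw [Nat.succ_add]
    simp only [Av, ih, List.cons_append]

lemma Av_eq_sum (n : ℕ) : ∀ (F : List α → ℝ),
    (∑ ω : Fin n → α, F (List.ofFn ω)) / (Fintype.card (Fin n → α) : ℝ) = Av α n F := by
  induction n with
  | zero => intro F; simp [Av]
  | succ n ih =>
    intro F
    simp only [Av, ← ih]
    rw [← (Fin.consEquiv (fun _ => α)).sum_comp, Fintype.sum_prod_type]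
    simp only [Fin.consEquiv_apply, List.ofFn_succ, Fin.cons_zero, Fin.cons_succ]
    rw [← Finset.sum_div, div_div]
    congr 1
    simp [pow_succ]

end av

lemma AvB (n : ℕ) (F : List Bool → ℝ) : Av Bool (n + 1) F =
    (Av Bool n (fun l => F (true :: l)) + Av Bool n (fun l => F (false :: l))) / 2 := by
  simp [Av]

lemma Av_repl (n : ℕ) : ∀ (F : List Bool → ℝ), (∀ l, 0 ≤ F l) →
    (1 / 2) ^ n * F (List.replicate n false) ≤ Av Bool n F := by
  induction n with
  | zero => intro F _; simp [Av]
  | succ n ih =>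
    intro F h
    rw [AvB, List.replicate_succ]
    have h1 := ih (fun l => F (false :: l)) (fun l => h _)
    have h2 : 0 ≤ Av Bool n (fun l => F (true :: l)) := by
      have := Av_mono n (fun _ => 0) (fun l => F (true :: l)) (fun l _ => h _)
      rwa [Av_const] at this
    rw [pow_succ]
    linarith

/-- sign -/
def sg (e : Bool) : ℤ := if e then 1 else -1

lemma Av_map (n : ℕ) : ∀ (F : List Bool → ℝ),
    Av Step n (fun l => F (l.map (fun s => s.2.1))) = Av Bool n F := by
  induction n with
  | zero => intro F; rfl
  | succ n ih =>
    intro F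
    rw [AvB, ← ih, ← ih]
    simp only [Av, List.map_cons]
    simp [Fintype.sum_prod_type]
    ring

abbrev D := DihedralGroup 0

/-- coordinate on the Cayley line -/
def p : D → ℤ
  | .r i => 2 * (show ℤ from i)
  | .sr i => 1 - 2 * (show ℤ from i)

/-- letters -/
def gen (c : Bool) : D := if c then .sr 0 else .sr 1

/-- direction of the `a` edge -/
def sig (v : D) : ℤ := match v with
  | .r _ => 1
  | .sr _ => -1

lemma p_r (i : ℤ) : p (.r (show ZMod 0 from i)) = 2 * i := rfl

lemma p_sr (i : ℤ) : p (.sr (show ZMod 0 from i)) = 1 - 2 * i := rfl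

lemma p_gen (v : D) (c : Bool) : p (v * gen c) = p v + sg c * sig v := by
  cases v with
  | r i =>
    change ℤ at i
    cases c
    · have h := p_sr ((1 : ℤ) - i)
      exact h.trans (by rw [show p (.r i) = 2 * i from rfl]; simp [sg, sig]; try ring)
    · have h := p_sr ((0 : ℤ) - i)
      exact h.trans (by rw [show p (.r i) = 2 * i from rfl]; simp [sg, sig]; try ring)
  | sr i =>
    change ℤ at i
    cases c
    · have h := p_r ((1 : ℤ) - i)
      exact h.trans (by rw [show p (.sr i) = 1 - 2 * i from rfl]; simp [sg, sig]; try ring)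
    · have h := p_r ((0 : ℤ) - i)
      exact h.trans (by rw [show p (.sr i) = 1 - 2 * i from rfl]; simp [sg, sig]; try ring)

lemma sig_gen (v : D) (c : Bool) : sig (v * gen c) = - sig v := by
  cases v <;> cases c <;> simp [gen, sig]

lemma gen_gen (v : D) (c : Bool) : v * gen c * gen c = v := by
  rw [mul_assoc]; cases c <;> simp [gen]

lemma p_one : p 1 = 0 := by
  show 2 * (0:ℤ) = 0
  norm_num

lemma sig_sq (v : D) : (sig v : ℝ) ^ 2 = 1 := by cases v <;> simp [sig]

lemma p_eq_zero (v : D) (h : p v = 0) : v = 1 := by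
  cases v with
  | r i =>
    have h2 : 2 * (show ℤ from i) = 0 := h
    have : (show ℤ from i) = 0 := by omega
    show DihedralGroup.r i = DihedralGroup.r 0
    congr 1
  | sr i =>
    exfalso
    have h2 : 1 - 2 * (show ℤ from i) = 0 := h
    omega

/-- averaging operators -/
noncomputable def op : List Bool → (D → ℝ) → D → ℝ
  | [], ψ, v => ψ v
  | c :: W, ψ, v => (op W ψ v + op W ψ (v * gen c)) / 2

lemma op_append (W V : List Bool) (ψ : D → ℝ) (v : D) :
    op (W ++ V) ψ v = op W (op V ψ) v := by
  induction W generalizing v with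
  | nil => rfl
  | cons c W ih => simp [op, ih]

/-- optional letter -/
def ow (P : Prop) [Decidable P] (c : Bool) : List Bool := if P then [c] else []

/-- optional group letter -/
def og (P : Prop) [Decidable P] (c e : Bool) : D := if P ∧ e = true then gen c else 1

lemma op_ow (P : Prop) [Decidable P] (c : Bool) (ψ : D → ℝ) (v : D) :
    op (ow P c) ψ v = (ψ (v * og P c false) + ψ (v * og P c true)) / 2 := by
  by_cases h : P <;> simp [ow, og, h, op]

/-- The word of letters applied to the lamp at `y`. -/
def W (k : ℕ) : List Bool → ℤ → List Bool
  | [], _ => []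
  | e :: η, y => ow (y = 0) true ++ (ow (y = k) false ++ (ow (y = sg e) true ++
      (ow (y = sg e + k) false ++ W k η (y - sg e))))

/-- The lamp at `y`. -/
def lam (k : ℕ) : List Step → ℤ → D
  | [], _ => 1
  | s :: l, y => og (y = 0) true s.1.1 * og (y = k) false s.1.2 * og (y = sg s.2.1) true s.2.2.1 *
      og (y = sg s.2.1 + k) false s.2.2.2 * lam k l (y - sg s.2.1)

def pos : List Bool → ℤ
  | [] => 0
  | e :: η => sg e + pos η

lemma op_lam (k n : ℕ) : ∀ (y : ℤ) (ψ : D → ℝ) (v : D),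
    Av Step n (fun l => ψ (v * lam k l y)) = Av Bool n (fun η => op (W k η y) ψ v) := by
  induction n with
  | zero => intro y ψ v; simp [Av, lam, W, op]
  | succ n ih =>
    intro y ψ v
    rw [AvB]
    simp only [Av, lam, W, op_append, op_ow, ← mul_assoc, ih]
    simp only [Fintype.sum_prod_type, Fintype.sum_bool]
    simp only [div_eq_mul_inv, Av_add, mul_comm _ ((2:ℝ)⁻¹), Av_mul]
    simp
    ring

/-- alternations -/
def alt : List Bool → ℕ
  | [] => 0
  | [_] => 0
  | c :: d :: V => (if c = d then 0 else 1) + alt (d :: V)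

/-- midpoint -/
noncomputable def mid (c : Bool) (v : D) : ℝ := p v + sg c * sig v / 2

lemma op_sq (V : List Bool) : ∀ (c : Bool) (v : D),
    op (c :: V) (fun v => (p v : ℝ) ^ 2) v = mid c v ^ 2 + 1 / 4 + alt (c :: V) := by
  induction V with
  | nil =>
    intro c v
    have h := sig_sq v
    simp only [op, alt, mid, p_gen]
    cases c <;> simp [sg] <;> linear_combination (1/4) * h
  | cons d V ih =>
    intro c v
    have h := sig_sq v
    rw [op, ih, ih]
    simp only [alt, mid, p_gen, sig_gen]
    cases c <;> cases d <;> simp [sg] <;> first | ring1 | linear_combination h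

lemma op_four (V : List Bool) : ∀ (c : Bool) (v : D),
    op (c :: V) (fun v => (p v : ℝ) ^ 4) v = mid c v ^ 4 + 6 * alt (c :: V) * mid c v ^ 2
      + 3 * (alt (c :: V) : ℝ) ^ 2 - 2 * alt (c :: V) + 3 / 2 * (mid c v ^ 2 + alt (c :: V))
      + 1 / 16 := by
  induction V with
  | nil =>
    intro c v
    simp only [op, alt, mid, p_gen]
    cases v <;> cases c <;> simp [sg, sig] <;> ring
  | cons d V ih =>
    intro c v
    rw [op, ih, ih]
    simp only [alt, mid, p_gen, sig_gen]
    cases v <;> cases c <;> cases d <;> simp [sg, sig] <;> ring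

lemma alt_lt (V : List Bool) : ∀ c, alt (c :: V) ≤ V.length := by
  induction V with
  | nil => intro c; simp [alt]
  | cons d V ih =>
    intro c
    have := ih d
    simp only [alt, List.length_cons]
    split_ifs <;> omega

lemma mid_one_sq (c : Bool) : mid c 1 ^ 2 = 1 / 4 := by
  have h := sig_sq 1
  simp only [mid, p_one]
  cases c <;> simp [sg] <;> linear_combination (1/4) * h

lemma op_sq_le (V : List Bool) : op V (fun v => (p v : ℝ) ^ 2) 1 ≤ V.length := by
  cases V with
  | nil => simp [op, p_one]
  | cons c V =>
    rw [op_sq, mid_one_sq]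
    have : (alt (c :: V) : ℝ) ≤ V.length := by exact_mod_cast alt_lt V c
    push_cast [List.length_cons]
    linarith

lemma op_sq_ge (V : List Bool) : (alt V : ℝ) ≤ op V (fun v => (p v : ℝ) ^ 2) 1 := by
  cases V with
  | nil => simp [op, p_one, alt]
  | cons c V =>
    rw [op_sq, mid_one_sq]
    linarith

lemma op_sq_ge' (V : List Bool) (hV : V ≠ []) :
    (alt V : ℝ) + 1 / 2 ≤ op V (fun v => (p v : ℝ) ^ 2) 1 := by
  cases V with
  | nil => simp at hV
  | cons c V =>
    rw [op_sq, mid_one_sq]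
    linarith

lemma op_four_le (V : List Bool) : op V (fun v => (p v : ℝ) ^ 4) 1 ≤ 3 * (V.length : ℝ) ^ 2 := by
  cases V with
  | nil => simp [op, p_one]
  | cons c V =>
    rw [op_four]
    have e : mid c 1 ^ 4 = (mid c 1 ^ 2) ^ 2 := by ring
    rw [e, mid_one_sq]
    have h : (alt (c :: V) : ℝ) ≤ V.length := by exact_mod_cast alt_lt V c
    have h0 : (0 : ℝ) ≤ alt (c :: V) := by positivity
    push_cast [List.length_cons]
    nlinarith

lemma alt_append (V V' : List Bool) : alt V + alt V' ≤ alt (V ++ V') := by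
  induction V with
  | nil => simp [alt]
  | cons c V ih =>
    cases V with
    | nil => cases V' <;> simp [alt]
    | cons d V =>
      simp only [List.cons_append, alt] at ih ⊢
      omega

lemma alt_pos (V : List Bool) (h1 : true ∈ V) (h2 : false ∈ V) : 1 ≤ alt V := by
  induction V with
  | nil => simp at h1
  | cons c V ih =>
    cases V with
    | nil => simp at h1 h2; rw [h1] at h2; simp at h2
    | cons d V =>
      by_cases h : c = d
      · subst h
        simp only [alt]
        have := ih (by simpa using h1) (by simpa using h2)
        omega
      · simp [alt, h]

lemma sum_ind_le (S : Finset ℤ) (z : ℤ) : ∑ y ∈ S, (if y = z then (1 : ℝ) else 0) ≤ 1 := by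
  rw [Finset.sum_ite_eq']
  split_ifs <;> norm_num

lemma sum_shift (S : Finset ℤ) (c : ℤ) (F : ℤ → ℝ) :
    ∑ y ∈ S, F (y - c) = ∑ y ∈ S.image (fun y => y - c), F y := by
  rw [Finset.sum_image]
  intro a _ b _ h
  simpa using h

lemma len_ow (P : Prop) [Decidable P] (c : Bool) :
    ((ow P c).length : ℝ) = if P then (1 : ℝ) else 0 := by
  unfold ow; split_ifs <;> simp

/-- number of letters added in one step -/
noncomputable def uu (k : ℕ) (e : Bool) (y : ℤ) : ℝ :=
  (if y = 0 then (1 : ℝ) else 0) + (if y = k then (1 : ℝ) else 0) +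
    (if y = sg e then (1 : ℝ) else 0) + (if y = sg e + k then (1 : ℝ) else 0)

lemma len_W (k : ℕ) (e : Bool) (η : List Bool) (y : ℤ) :
    ((W k (e :: η) y).length : ℝ) = uu k e y + (W k η (y - sg e)).length := by
  simp only [W, List.length_append, Nat.cast_add, len_ow, uu]
  ring

lemma uu_nonneg (k : ℕ) (e : Bool) (y : ℤ) : 0 ≤ uu k e y := by
  unfold uu; positivity

lemma uu_le (k : ℕ) (e : Bool) (y : ℤ) : uu k e y ≤ 4 := by
  unfold uu; split_ifs <;> norm_num

lemma sum_uu (k : ℕ) (e : Bool) (S : Finset ℤ) : ∑ y ∈ S, uu k e y ≤ 4 := by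
  simp only [uu, Finset.sum_add_distrib]
  have h1 := sum_ind_le S 0
  have h2 := sum_ind_le S k
  have h3 := sum_ind_le S (sg e)
  have h4 := sum_ind_le S (sg e + k)
  linarith

lemma sum_W_le (k : ℕ) (η : List Bool) : ∀ S : Finset ℤ,
    ∑ y ∈ S, ((W k η y).length : ℝ) ≤ 4 * η.length := by
  induction η with
  | nil => intro S; simp [W]
  | cons e η ih =>
    intro S
    simp only [len_W, Finset.sum_add_distrib]
    rw [sum_shift S (sg e) (fun y => ((W k η y).length : ℝ))]
    have h1 := sum_uu k e S
    have h2 := ih (S.image (fun y => y - sg e))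
    push_cast [List.length_cons]
    linarith

/-- potential -/
noncomputable def q (y : ℤ) : ℝ := 2 * |(y : ℝ)| + if y = 0 then (1 : ℝ) else 0

lemma q_avg (y : ℤ) : (q (y - sg true) + q (y - sg false)) / 2 = q y +
    (if y = 0 then (1 : ℝ) else 0) +
    ((if y = sg true then (1 : ℝ) else 0) + (if y = sg false then (1 : ℝ) else 0)) / 2 := by
  have hz : (2 * |y - 1| + (if y - 1 = 0 then 1 else 0)) + (2 * |y + 1| + (if y + 1 = 0 then 1 else 0))
      = 2 * (2 * |y| + (if y = 0 then (1 : ℤ) else 0) + (if y = 0 then 1 else 0)) +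
      ((if y = 1 then 1 else 0) + (if y = -1 then 1 else 0)) := by
    rcases abs_cases (y - 1) with h1 | h1 <;> rcases abs_cases (y + 1) with h2 | h2 <;>
      rcases abs_cases y with h3 | h3 <;> rw [h1.1, h2.1, h3.1] <;> split_ifs <;> omega
  have hr : (2 * |(y : ℝ) - 1| + (if y - 1 = 0 then 1 else 0)) + (2 * |(y : ℝ) + 1| + (if y + 1 = 0 then 1 else 0))
      = 2 * (2 * |(y : ℝ)| + (if y = 0 then (1 : ℝ) else 0) + (if y = 0 then 1 else 0)) +
      ((if y = 1 then 1 else 0) + (if y = -1 then 1 else 0)) := by exact_mod_cast hz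
  simp only [q, sg, if_true, Bool.false_eq_true, if_false, sub_neg_eq_add]
  push_cast
  linarith

lemma w_eq (k n : ℕ) : ∀ y : ℤ, Av Bool n (fun η => ((W k η y).length : ℝ)) + (q y + q (y - k)) =
    Av Bool n (fun η => q (y - pos η) + q (y - k - pos η)) := by
  induction n with
  | zero => intro y; simp [Av, W, pos]
  | succ n ih =>
    intro y
    have e1 : ∀ e η, q (y - pos (e :: η)) + q (y - k - pos (e :: η)) =
        q (y - sg e - pos η) + q (y - sg e - k - pos η) := by
      intro e η
      simp only [pos]
      congr 2 <;> ring
    simp only [AvB, e1, ← ih]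
    simp only [len_W, Av_add, Av_const, uu]
    have h1 := q_avg y
    have h2 := q_avg (y - k)
    have e2 : ∀ z : ℤ, (y - k = z) = (y = z + k) := fun z => by
      apply propext; constructor <;> intro h <;> linarith
    simp only [e2] at h2
    rw [show ((0:ℤ) + k) = k by ring] at h2
    rw [show y - k - sg true = y - sg true - k by ring,
      show y - k - sg false = y - sg false - k by ring] at h2
    linarith

lemma Av_pos_sq (n : ℕ) : ∀ y : ℤ, Av Bool n (fun η => ((y - pos η : ℤ) : ℝ) ^ 2) =
    (y : ℝ) ^ 2 + n := by
  induction n with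
  | zero => intro y; simp [Av, pos]
  | succ n ih =>
    intro y
    have e1 : ∀ e η, y - pos (e :: η) = y - sg e - pos η := by
      intro e η
      simp only [pos]
      ring
    simp only [AvB, e1, ih]
    simp [sg]
    ring

lemma Av_q (n : ℕ) (y : ℤ) : Av Bool n (fun η => q (y - pos η)) ≤ q y + 2 * √n + 1 := by
  have hs : 0 ≤ √(n : ℝ) := Real.sqrt_nonneg _
  have hs2 : √(n : ℝ) ^ 2 = n := Real.sq_sqrt (by positivity)
  rcases Nat.eq_zero_or_pos n with rfl | hn
  · simp [Av, pos]
  have hs' : 0 < √(n : ℝ) := by positivity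
  set t : ℝ := |(y : ℝ)| + √n with ht
  have htp : 0 < t := by positivity
  have hb : ∀ z : ℤ, q z ≤ (1 / t) * (z : ℝ) ^ 2 + (t + 1) := by
    intro z
    have h1 : 2 * |(z : ℝ)| ≤ (1 / t) * (z : ℝ) ^ 2 + t := by
      rw [← sq_abs (z : ℝ)]
      have : (1 / t) * |(z : ℝ)| ^ 2 + t - 2 * |(z : ℝ)| = (|(z : ℝ)| - t) ^ 2 / t := by
        field_simp; ring
      have h2 : 0 ≤ (|(z : ℝ)| - t) ^ 2 / t := by positivity
      linarith
    unfold q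
    split_ifs <;> linarith
  have h1 := Av_mono n _ _ (fun η (_ : η.length = n) => hb (y - pos η))
  rw [Av_add, Av_mul, Av_pos_sq, Av_const] at h1
  have h2 : (1 / t) * ((y : ℝ) ^ 2 + n) ≤ t := by
    rw [one_div, inv_mul_le_iff₀ htp, ht, ← sq_abs (y : ℝ)]
    have : 0 ≤ |(y : ℝ)| := abs_nonneg _
    nlinarith
  have h3 : 2 * |(y : ℝ)| ≤ q y := by unfold q; split_ifs <;> linarith
  linarith

lemma w_le (k n : ℕ) (y : ℤ) : Av Bool n (fun η => ((W k η y).length : ℝ)) ≤ 4 * √n + 2 := by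
  have h := w_eq k n y
  rw [Av_add] at h
  have h1 := Av_q n y
  have h2 := Av_q n (y - k)
  linarith

lemma sum_W_sq (k n : ℕ) : ∀ S : Finset ℤ,
    ∑ y ∈ S, Av Bool n (fun η => ((W k η y).length : ℝ) ^ 2) ≤ n * (32 * √n + 32) := by
  induction n with
  | zero => intro S; simp [Av, W]
  | succ n ih =>
    intro S
    have hsn : √(n : ℝ) ≤ √((n + 1 : ℕ) : ℝ) := Real.sqrt_le_sqrt (by push_cast; linarith)
    have key : ∀ e : Bool, ∑ y ∈ S, Av Bool n (fun η => ((W k (e :: η) y).length : ℝ) ^ 2) ≤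
        16 + 8 * (4 * √n + 2) + n * (32 * √n + 32) := by
      intro e
      have hy : ∀ y, Av Bool n (fun η => ((W k (e :: η) y).length : ℝ) ^ 2) ≤
          4 * uu k e y + 2 * uu k e y * (4 * √n + 2) +
          Av Bool n (fun η => ((W k η (y - sg e)).length : ℝ) ^ 2) := by
        intro y
        have h0 := uu_nonneg k e y
        have h4 := uu_le k e y
        have e1 : ∀ η, ((W k (e :: η) y).length : ℝ) ^ 2 = uu k e y ^ 2 +
            2 * uu k e y * (W k η (y - sg e)).length + ((W k η (y - sg e)).length : ℝ) ^ 2 := by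
          intro η; rw [len_W]; ring
        simp only [e1, Av_add, Av_mul, Av_const]
        have h5 := w_le k n (y - sg e)
        have h6 : 2 * uu k e y * Av Bool n (fun η => ((W k η (y - sg e)).length : ℝ)) ≤
          2 * uu k e y * (4 * √n + 2) := by gcongr
        nlinarith
      refine (Finset.sum_le_sum fun y _ => hy y).trans ?_
      rw [Finset.sum_add_distrib, Finset.sum_add_distrib, ← Finset.mul_sum, ← Finset.sum_mul,
        ← Finset.mul_sum,
        sum_shift S (sg e) (fun y => Av Bool n (fun η => ((W k η y).length : ℝ) ^ 2))]
      have h1 := sum_uu k e S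
      have h2 := ih (S.image (fun y => y - sg e))
      have h3 : 0 ≤ √(n : ℝ) := Real.sqrt_nonneg _
      nlinarith
    simp only [AvB, ← Finset.sum_div, Finset.sum_add_distrib]
    have k1 := key true
    have k2 := key false
    have h3 : (n : ℝ) * √n ≤ n * √((n + 1 : ℕ) : ℝ) := by gcongr
    push_cast at *
    nlinarith

lemma W_append (k : ℕ) (η η' : List Bool) : ∀ y,
    W k (η ++ η') y = W k η y ++ W k η' (y - pos η) := by
  induction η with
  | nil => intro y; simp [W, pos]
  | cons e η ih =>
    intro y
    simp only [List.cons_append, W, ih, List.append_assoc, pos, sub_sub]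

lemma W_repl (k : ℕ) : ∀ (j : ℕ), j ≤ k →
    false ∈ W k (List.replicate (j + 1) false) ((k : ℤ) - j) := by
  intro j
  induction j with
  | zero =>
    intro _
    simp [List.replicate, W, ow]
  | succ j ih =>
    intro h
    have := ih (by omega)
    rw [List.replicate_succ]
    simp only [W, List.mem_append]
    right; right; right; right
    convert this using 2
    simp [sg]; ring

lemma alt_repl (k : ℕ) : 1 ≤ alt (W k (List.replicate (k + 1) false) 0) := by
  apply alt_pos
  · simp [List.replicate_succ, W, ow]
  · simpa using W_repl k k le_rfl

lemma pos_bd (η : List Bool) : |pos η| ≤ η.length := by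
  induction η with
  | nil => simp [pos]
  | cons e η ih =>
    simp only [pos, List.length_cons]
    rw [abs_le] at *
    cases e <;> simp [sg] <;> omega

lemma alt_lower (k : ℕ) (m : ℕ) : ∀ (r : ℕ) (S : Finset ℤ),
    Finset.Icc (-((m * (k + 1) + r : ℕ) : ℤ)) ((m * (k + 1) + r : ℕ) : ℤ) ⊆ S →
    m * (1 / 2 : ℝ) ^ (k + 1) ≤
      Av Bool (m * (k + 1) + r) (fun η => ∑ y ∈ S, (alt (W k η y) : ℝ)) := by
  induction m with
  | zero =>
    intro r S _
    have := Av_mono (0 * (k + 1) + r) (fun _ => (0 : ℝ)) (fun η => ∑ y ∈ S, (alt (W k η y) : ℝ))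
      (fun l _ => by positivity)
    rw [Av_const] at this
    simpa using this
  | succ m ih =>
    intro r S hS
    have e0 : (m + 1) * (k + 1) + r = (k + 1) + (m * (k + 1) + r) := by ring
    rw [e0] at hS ⊢
    rw [Av_append]
    have step : Av Bool (k + 1) (fun l => ∑ y ∈ S, (alt (W k l y) : ℝ) + m * (1 / 2 : ℝ) ^ (k + 1)) ≤
        Av Bool (k + 1) (fun l => Av Bool (m * (k + 1) + r)
          (fun l' => ∑ y ∈ S, (alt (W k (l ++ l') y) : ℝ))) := by
      apply Av_mono
      intro l hl
      have h1 : Av Bool (m * (k + 1) + r) (fun l' => ∑ y ∈ S, (alt (W k l y) : ℝ) +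
          ∑ y ∈ S, (alt (W k l' (y - pos l)) : ℝ)) ≤ Av Bool (m * (k + 1) + r)
          (fun l' => ∑ y ∈ S, (alt (W k (l ++ l') y) : ℝ)) := by
        apply Av_mono
        intro l' _
        rw [← Finset.sum_add_distrib]
        apply Finset.sum_le_sum
        intro y _
        rw [W_append]
        exact_mod_cast alt_append _ _
      refine le_trans ?_ h1
      rw [Av_add, Av_const]
      gcongr
      have h2 := ih r (S.image (fun y => y - pos l)) (by
        intro z hz
        rw [Finset.mem_image]
        refine ⟨z + pos l, hS ?_, by ring⟩
        have hp := pos_bd l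
        rw [hl, abs_le] at hp
        rw [Finset.mem_Icc] at *
        push_cast at *
        constructor <;> linarith [hp.1, hp.2, hz.1, hz.2])
      refine h2.trans (le_of_eq ?_)
      congr 1
      funext l'
      rw [sum_shift S (pos l) (fun y => (alt (W k l' y) : ℝ))]
    refine le_trans ?_ step
    rw [Av_add, Av_const]
    have h3 := Av_repl (k + 1) (fun l => ∑ y ∈ S, (alt (W k l y) : ℝ)) (fun l => by positivity)
    have h4 : (1 : ℝ) ≤ ∑ y ∈ S, (alt (W k (List.replicate (k + 1) false) y) : ℝ) := by
      have h5 : (1 : ℝ) ≤ alt (W k (List.replicate (k + 1) false) 0) := by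
        exact_mod_cast alt_repl k
      refine h5.trans (Finset.single_le_sum
        (f := fun y => (alt (W k (List.replicate (k + 1) false) y) : ℝ))
        (fun _ _ => by positivity) (hS ?_))
      rw [Finset.mem_Icc]
      constructor <;> omega
    have h6 : 0 < (1 / 2 : ℝ) ^ (k + 1) := by positivity
    push_cast
    nlinarith

/-- running maximum (of the walk or its negative) -/
def mm (b : Bool) : List Bool → ℤ
  | [] => 0
  | e :: η => max 0 (sg b * sg e + mm b η)

lemma mm_nonneg (b : Bool) (η : List Bool) : 0 ≤ mm b η := by
  cases η <;> simp [mm]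

lemma mm_le (b : Bool) (η : List Bool) : mm b η ≤ η.length := by
  induction η with
  | nil => simp [mm]
  | cons e η ih =>
    simp only [mm, List.length_cons]
    cases b <;> cases e <;> simp [sg] <;> omega

lemma Av_mm_sq (b : Bool) (n : ℕ) : Av Bool n (fun η => (mm b η : ℝ) ^ 2) ≤ n := by
  induction n with
  | zero => simp [Av, mm]
  | succ n ih =>
    rw [AvB, ← Av_add]
    have h1 : Av Bool n (fun η => (mm b (true :: η) : ℝ) ^ 2 + (mm b (false :: η) : ℝ) ^ 2) ≤
        Av Bool n (fun η => 2 * (mm b η : ℝ) ^ 2 + 2) := by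
      apply Av_mono
      intro η _
      have h0 := mm_nonneg b η
      have hz : (mm b (true :: η)) ^ 2 + (mm b (false :: η)) ^ 2 ≤ 2 * (mm b η) ^ 2 + 2 := by
        simp only [mm]
        generalize mm b η = m at *
        have ha : max 0 (1 + m) = 1 + m := max_eq_right (by omega)
        have hb : (max 0 (-1 + m)) ^ 2 ≤ (-1 + m) ^ 2 := by
          rcases le_total 0 (-1 + m) with h | h
          · rw [max_eq_right h]
          · rw [max_eq_left h]; positivity
        cases b <;> simp only [sg, if_true, Bool.false_eq_true, if_false, mul_one, one_mul,
          neg_mul, neg_neg, mul_neg] <;> rw [ha] <;> nlinarith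
      exact_mod_cast hz
    rw [Av_add n (fun η => 2 * (mm b η : ℝ) ^ 2), Av_mul, Av_const] at h1
    push_cast
    linarith

lemma Av_mm (b : Bool) (n : ℕ) (hn : 1 ≤ n) : Av Bool n (fun η => (mm b η : ℝ)) ≤ √n := by
  have hs2 : √(n : ℝ) ^ 2 = n := Real.sq_sqrt (by positivity)
  have hs' : 0 < √(n : ℝ) := by positivity
  set t := √(n : ℝ)
  have h1 : Av Bool n (fun η => (mm b η : ℝ)) ≤
      Av Bool n (fun η => (1 / (2 * t)) * (mm b η : ℝ) ^ 2 + t / 2) := by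
    apply Av_mono
    intro η _
    have : (1 / (2 * t)) * (mm b η : ℝ) ^ 2 + t / 2 - mm b η = (mm b η - t) ^ 2 / (2 * t) := by
      field_simp; ring
    have h2 : 0 ≤ ((mm b η : ℝ) - t) ^ 2 / (2 * t) := by positivity
    linarith
  rw [Av_add, Av_mul, Av_const] at h1
  have h2 : (1 / (2 * t)) * Av Bool n (fun η => (mm b η : ℝ) ^ 2) ≤ (1 / (2 * t)) * n := by
    gcongr; exact Av_mm_sq b n
  have h3 : (1 / (2 * t)) * n = t / 2 := by rw [← hs2]; field_simp
  linarith

lemma pos_mm (η : List Bool) : -mm false η ≤ pos η ∧ pos η ≤ mm true η := by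
  induction η with
  | nil => simp [mm, pos]
  | cons e η ih =>
    simp only [mm, pos]
    cases e <;> simp [sg] <;> omega

/-- moves -/
abbrev mv (l : List Step) : List Bool := l.map (fun s => s.2.1)

lemma lam_supp (k : ℕ) (l : List Step) : ∀ y : ℤ,
    (y < -mm false (mv l) ∨ mm true (mv l) + k < y) → lam k l y = 1 := by
  induction l with
  | nil => intro y _; rfl
  | cons s l ih =>
    intro y hy
    simp only [mv, List.map_cons, mm] at hy
    have a1 := mm_nonneg true (mv l)
    have a2 := mm_nonneg false (mv l)
    simp only [mv] at *
    have hs : sg s.2.1 = 1 ∨ sg s.2.1 = -1 := by unfold sg; split_ifs <;> simp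
    have e1 : sg true = 1 := rfl
    have e2 : sg false = -1 := rfl
    rw [e1, e2] at hy
    simp only [lam, og]
    rw [ih (y - sg s.2.1) (by omega), if_neg (by omega), if_neg (by omega), if_neg (by omega),
      if_neg (by omega)]
    simp

abbrev G := Wr ℤ D

lemma left_mul (g h : G) (x : ℤ) :
    (g * h).left x = g.left x * h.left (x - Multiplicative.toAdd g.right) := rfl

/-- single letter -/
def lett (z : ℤ) (c : Bool) : G := ⟨delta z (gen c), 1⟩

lemma alpha_eq : alphaG 0 = lett 0 true := rfl
lemma beta_eq (k : ℕ) : betaG k 0 = lett k false := rfl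

lemma lett_left (z : ℤ) (c e : Bool) (x : ℤ) : (pw (lett z c) e).left x = og (x = z) c e := by
  cases e <;> simp [pw, lett, delta, og]

lemma lett_right (z : ℤ) (c e : Bool) : (pw (lett z c) e).right = 1 := by
  cases e <;> simp [pw, lett]

lemma tau_pow (z : ℤ) : (tauG 0) ^ z = (⟨1, Multiplicative.ofAdd z⟩ : G) := by
  have : tauG 0 = SemidirectProduct.inr (Multiplicative.ofAdd (1 : ℤ)) := rfl
  rw [this, ← map_zpow, ← ofAdd_zsmul]
  simp

lemma step_mul_left (k : ℕ) (s : Step) (g : G) (y : ℤ) :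
    (stepElt k 0 s * g).left y =
      og (y = 0) true s.1.1 * og (y = k) false s.1.2 * og (y = sg s.2.1) true s.2.2.1 *
      og (y = sg s.2.1 + k) false s.2.2.2 * g.left (y - sg s.2.1) := by
  have e1 : (y - sg s.2.1 = 0) = (y = sg s.2.1) := by rw [sub_eq_zero]
  have e2 : (y - sg s.2.1 = k) = (y = sg s.2.1 + k) := by
    apply propext; constructor <;> intro h <;> linarith
  have e3 : (if s.2.1 = true then (1 : ℤ) else -1) = sg s.2.1 := rfl
  simp only [stepElt, mul_assoc, alpha_eq, beta_eq, left_mul, lett_left, lett_right, tau_pow,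
    toAdd_one, sub_zero, e3, toAdd_ofAdd]
  simp [og, e1, e2]

lemma step_mul_right (k : ℕ) (s : Step) (g : G) :
    (stepElt k 0 s * g).right = Multiplicative.ofAdd (sg s.2.1) * g.right := by
  have e3 : (if s.2.1 = true then (1 : ℤ) else -1) = sg s.2.1 := rfl
  simp only [stepElt, alpha_eq, beta_eq, tau_pow, SemidirectProduct.mul_right, lett_right, e3]
  simp

/-- position of the walk -/
def Z (k : ℕ) (l : List Step) : G := (l.map (stepElt k 0)).prod

lemma Z_left (k : ℕ) (l : List Step) : ∀ y, (Z k l).left y = lam k l y := by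
  induction l with
  | nil => intro y; rfl
  | cons s l ih =>
    intro y
    rw [Z, List.map_cons, List.prod_cons, step_mul_left, lam, ← ih]
    rfl

lemma Z_right (k : ℕ) (l : List Step) : (Z k l).right = Multiplicative.ofAdd (pos (mv l)) := by
  induction l with
  | nil => rfl
  | cons s l ih =>
    rw [Z, List.map_cons, List.prod_cons, step_mul_right]
    rw [Z] at ih
    rw [ih]
    rfl

lemma walkE_eq (k n : ℕ) : walkE k 0 n =
    Av Step n (fun l => (lengthWrt (swsSet k 0) (Z k l) : ℝ)) := by
  rw [← Av_eq_sum, walkE]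
  congr 1
  apply Finset.sum_congr rfl
  intro ω _
  rw [Z, List.map_ofFn, List.ofFn_eq_map]
  rfl

lemma pw_swsU (k : ℕ) (e e' : Bool) : pw (alphaG 0) e * pw (betaG k 0) e' ∈ swsU k 0 :=
  ⟨e, e', Or.inl rfl⟩

lemma one_swsU (k : ℕ) : (1 : G) ∈ swsU k 0 := ⟨false, false, Or.inl (by simp [pw])⟩

lemma step_mem (k : ℕ) (s : Step) : stepElt k 0 s ∈ swsSet k 0 := by
  refine ⟨_, pw_swsU k s.1.1 s.1.2, _, pw_swsU k s.2.2.1 s.2.2.2, ?_⟩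
  cases h : s.2.1
  · right; simp [stepElt, h, mul_assoc]
  · left; simp [stepElt, h, mul_assoc]

/-- total lamp length -/
noncomputable def Phi (S : Finset ℤ) (g : G) : ℝ := ∑ x ∈ S, |(p (g.left x) : ℝ)|

lemma Phi_lett (S : Finset ℤ) (g : G) (z : ℤ) (c e : Bool) :
    Phi S (g * pw (lett z c) e) ≤ Phi S g + 1 := by
  have h : ∀ x, |(p ((g * pw (lett z c) e).left x) : ℝ)| ≤ |(p (g.left x) : ℝ)| +
      if x = z + Multiplicative.toAdd g.right then (1 : ℝ) else 0 := by
    intro x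
    rw [left_mul, lett_left, og]
    by_cases hx : x = z + Multiplicative.toAdd g.right
    · rw [if_pos hx]
      split_ifs
      · rw [p_gen]
        push_cast
        refine (abs_add_le _ _).trans ?_
        gcongr
        have hg : |(sig (g.left x) : ℝ)| = 1 := by
          rw [← sq_eq_sq₀ (abs_nonneg _) zero_le_one, sq_abs, sig_sq]; norm_num
        rw [abs_mul, hg]
        cases c <;> simp [sg]
      · simp
    · rw [if_neg hx, if_neg]
      · simp
      · rintro ⟨h, -⟩; apply hx; rw [← h]; ring
  refine (Finset.sum_le_sum fun x _ => h x).trans ?_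
  rw [Finset.sum_add_distrib]
  have := sum_ind_le S (z + Multiplicative.toAdd g.right)
  unfold Phi
  linarith

lemma Phi_tau (S : Finset ℤ) (g : G) (z : ℤ) : Phi S (g * tauG 0 ^ z) = Phi S g := by
  unfold Phi
  apply Finset.sum_congr rfl
  intro x _
  rw [left_mul, tau_pow]
  simp

lemma Phi_U (k : ℕ) (S : Finset ℤ) (g u : G) (hu : u ∈ swsU k 0) :
    Phi S (g * u) ≤ Phi S g + 2 := by
  obtain ⟨e, e', rfl | rfl⟩ := hu
  · rw [alpha_eq, beta_eq, ← mul_assoc]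
    have h1 := Phi_lett S g 0 true e
    have h2 := Phi_lett S (g * pw (lett 0 true) e) k false e'
    linarith
  · rw [alpha_eq, beta_eq, ← mul_assoc]
    have h1 := Phi_lett S g k false e
    have h2 := Phi_lett S (g * pw (lett k false) e) 0 true e'
    linarith

lemma Phi_S (k : ℕ) (S : Finset ℤ) (g s : G) (hs : s ∈ swsSet k 0) :
    Phi S (g * s) ≤ Phi S g + 4 := by
  obtain ⟨u₁, h₁, u₂, h₂, hh⟩ := hs
  have key : ∀ z : ℤ, Phi S (g * (u₁ * tauG 0 ^ z * u₂)) ≤ Phi S g + 4 := by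
    intro z
    have a1 := Phi_U k S g u₁ h₁
    have a2 := Phi_U k S (g * u₁ * tauG 0 ^ z) u₂ h₂
    rw [Phi_tau] at a2
    simp only [← mul_assoc]
    linarith
  rcases hh with rfl | rfl
  · simpa using key 1
  · simpa using key (-1)

lemma Phi_list (k : ℕ) (S : Finset ℤ) (L : List G) : ∀ g, (∀ x ∈ L, x ∈ swsSet k 0) →
    Phi S (g * L.prod) ≤ Phi S g + 4 * L.length := by
  induction L with
  | nil => intro g _; simp
  | cons s L ih =>
    intro g h
    have h1 := ih (g * s) (fun x hx => h x (by simp [hx]))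
    have h2 := Phi_S k S g s (h s (by simp))
    rw [List.prod_cons, ← mul_assoc]
    push_cast [List.length_cons]
    linarith

lemma length_lower (k : ℕ) (S : Finset ℤ) (l : List Step) :
    ∑ x ∈ S, |(p (lam k l x) : ℝ)| ≤ 4 * (lengthWrt (swsSet k 0) (Z k l) : ℝ) := by
  have hne : {n | ∃ L : List G, (∀ x ∈ L, x ∈ swsSet k 0) ∧ L.length = n ∧ L.prod = Z k l}.Nonempty := by
    refine ⟨_, l.map (stepElt k 0), ?_, rfl, rfl⟩
    intro x hx
    rw [List.mem_map] at hx
    obtain ⟨s, -, rfl⟩ := hx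
    exact step_mem k s
  obtain ⟨L, h1, h2, h3⟩ := Nat.sInf_mem hne
  have h := Phi_list k S L 1 h1
  rw [h2, one_mul, h3] at h
  have e1 : Phi S (Z k l) = ∑ x ∈ S, |(p (lam k l x) : ℝ)| := by
    simp only [Phi, Z_left]
  have e2 : Phi S (1 : G) = 0 := by
    simp [Phi, p_one]
  rw [e1, e2, zero_add] at h
  exact h

/-- length at most `n` -/
def LL (k : ℕ) (g : G) (n : ℕ) : Prop :=
  ∃ L : List G, (∀ x ∈ L, x ∈ swsSet k 0) ∧ L.length = n ∧ L.prod = g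

lemma LL_mul {k : ℕ} {g h : G} {m n : ℕ} (hg : LL k g m) (hh : LL k h n) : LL k (g * h) (m + n) := by
  obtain ⟨L, a1, a2, a3⟩ := hg
  obtain ⟨M, b1, b2, b3⟩ := hh
  refine ⟨L ++ M, ?_, by simp [a2, b2], by simp [a3, b3]⟩
  intro x hx
  rcases List.mem_append.1 hx with h | h
  · exact a1 x h
  · exact b1 x h

lemma LL_one (k : ℕ) : LL k 1 0 := ⟨[], by simp, rfl, rfl⟩

lemma LL_of_mem {k : ℕ} {g : G} (h : g ∈ swsSet k 0) : LL k g 1 := ⟨[g], by simpa using h, rfl, by simp⟩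

lemma LL_tau (k : ℕ) : LL k (tauG 0) 1 :=
  LL_of_mem ⟨1, one_swsU k, 1, one_swsU k, Or.inl (by simp)⟩

lemma LL_tau_inv (k : ℕ) : LL k (tauG 0)⁻¹ 1 :=
  LL_of_mem ⟨1, one_swsU k, 1, one_swsU k, Or.inr (by simp)⟩

lemma LL_pow {k : ℕ} {g : G} (h : LL k g 1) (n : ℕ) : LL k (g ^ n) n := by
  induction n with
  | zero => exact LL_one k
  | succ n ih => rw [pow_succ]; exact LL_mul ih h

lemma LL_zpow (k : ℕ) (z : ℤ) : LL k (tauG 0 ^ z) z.natAbs := by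
  rcases Int.natAbs_eq z with h | h
  · have := LL_pow (LL_tau k) z.natAbs
    rwa [← zpow_natCast, ← h] at this
  · have := LL_pow (LL_tau_inv k) z.natAbs
    rwa [← zpow_natCast, inv_zpow', ← h] at this

lemma LL_gen (k : ℕ) (c : Bool) : ∃ m ≤ 2 * k + 2, LL k (lett 0 c) m := by
  cases c
  · have h1 : LL k (betaG k 0) (1 + 1) := by
      have : betaG k 0 = betaG k 0 * tauG 0 * 1 * (tauG 0)⁻¹ := by group
      rw [this]
      refine LL_mul (LL_of_mem ⟨_, ⟨false, true, Or.inl rfl⟩, 1, one_swsU k, Or.inl ?_⟩) (LL_tau_inv k)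
      simp [pw]
    refine ⟨(-(k : ℤ)).natAbs + (1 + 1) + (k : ℤ).natAbs, ?_, ?_⟩
    rotate_left
    · have h2 := LL_mul (LL_mul (LL_zpow k (-(k : ℤ))) h1) (LL_zpow k k)
      have e : lett 0 false = tauG 0 ^ (-(k : ℤ)) * betaG k 0 * tauG 0 ^ (k : ℤ) := by
        apply SemidirectProduct.ext
        · funext x
          simp only [left_mul, tau_pow, beta_eq]
          simp [lett, delta]
        · simp only [tau_pow, beta_eq, SemidirectProduct.mul_right]
          simp [lett]
      rw [e]
      exact h2
    · simp; omega
  · refine ⟨1 + 1, by omega, ?_⟩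
    have : lett 0 true = alphaG 0 * tauG 0 * 1 * (tauG 0)⁻¹ := by rw [← alpha_eq]; group
    rw [this]
    refine LL_mul (LL_of_mem ⟨_, ⟨true, false, Or.inl rfl⟩, 1, one_swsU k, Or.inl ?_⟩) (LL_tau_inv k)
    simp [pw]

lemma delta_mul (v w : D) : (⟨delta 0 (v * w), 1⟩ : G) = ⟨delta 0 v, 1⟩ * ⟨delta 0 w, 1⟩ := by
  apply SemidirectProduct.ext
  · funext x
    rw [left_mul]
    by_cases h : x = 0 <;> simp [delta, h]
  · simp

lemma LL_delta (k : ℕ) : ∀ (N : ℕ) (v : D), (p v).natAbs = N →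
    ∃ m ≤ (2 * k + 2) * N, LL k ⟨delta 0 v, 1⟩ m := by
  intro N
  induction N with
  | zero =>
    intro v hv
    have hv : v = 1 := p_eq_zero v (by omega)
    refine ⟨0, by simp, ?_⟩
    have e : (⟨delta 0 v, 1⟩ : G) = 1 := by
      subst hv
      apply SemidirectProduct.ext
      · funext x; simp [delta]
      · rfl
    rw [e]
    exact LL_one k
  | succ N ih =>
    intro v hv
    have hc : ∃ c : Bool, (p (v * gen c)).natAbs = N := by
      have hs : sig v = 1 ∨ sig v = -1 := by cases v <;> simp [sig]
      by_cases h : sig v * p v < 0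
      · refine ⟨true, ?_⟩
        rw [p_gen]
        rcases hs with hs | hs <;> rw [hs] at h ⊢ <;> simp [sg] <;> omega
      · refine ⟨false, ?_⟩
        rw [p_gen]
        rcases hs with hs | hs <;> rw [hs] at h ⊢ <;> simp [sg] <;> omega
    obtain ⟨c, hc⟩ := hc
    obtain ⟨m, hm, h1⟩ := ih _ hc
    obtain ⟨m', hm', h2⟩ := LL_gen k c
    refine ⟨m + m', by rw [mul_add]; omega, ?_⟩
    have := LL_mul h1 h2
    rw [lett, ← delta_mul, gen_gen] at this
    exact this

lemma LL_interval (k : ℕ) (f : ℤ → D) (A : ℤ) (N : ℕ) :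
    ∃ m : ℕ, (m : ℤ) ≤ |A| + N + (2 * k + 2) * ∑ x ∈ Finset.Ico (-A) (-A + N), |p (f x)| ∧
      LL k ⟨fun x => if x ∈ Finset.Ico (-A) (-A + N) then f x else 1,
        Multiplicative.ofAdd (-A + N)⟩ m := by
  induction N with
  | zero =>
    refine ⟨(-A).natAbs, by simp, ?_⟩
    have := LL_zpow k (-A)
    rw [tau_pow] at this
    convert this using 2
    · funext x; simp
    · simp
  | succ N ih =>
    obtain ⟨m, hm, h1⟩ := ih
    obtain ⟨m', hm', h2⟩ := LL_delta k _ (f (-A + N)) rfl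
    have h3 := LL_mul (LL_mul h1 h2) (LL_tau k)
    have hI : Finset.Ico (-A) (-A + (N + 1 : ℕ)) = insert (-A + (N : ℤ)) (Finset.Ico (-A) (-A + N)) := by
      ext x; simp only [Finset.mem_insert, Finset.mem_Ico]; push_cast; omega
    refine ⟨m + m' + 1, ?_, ?_⟩
    rotate_left
    · convert h3 using 1
      apply SemidirectProduct.ext
      · funext x
        simp only [left_mul, hI, Finset.mem_insert]
        by_cases hx : x = -A + N
        · subst hx
          simp [delta, tauG]
        · have : x - (-A + N) ≠ 0 := by intro h; apply hx; linarith
          have hx' : ¬ (x - (N:ℤ) + A = 0) := by intro h; apply hx; linarith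
          simp [delta, tauG, hx, this]
          
      · simp only [SemidirectProduct.mul_right, tauG, mul_one]
        rw [← ofAdd_add]; congr 1; push_cast; ring
    · rw [hI, Finset.sum_insert (by simp)]
      have : (m' : ℤ) ≤ (2 * k + 2) * |p (f (-A + N))| := by
        rw [Int.abs_eq_natAbs]; exact_mod_cast hm'
      push_cast
      rw [mul_add]
      linarith

lemma length_upper (k : ℕ) (l : List Step) (A B : ℤ) (hA : A = mm false (mv l))
    (hB : B = mm true (mv l)) :
    (lengthWrt (swsSet k 0) (Z k l) : ℝ) ≤ 3 * (A + B + k + 1) +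
      (2 * k + 2) * ∑ x ∈ Finset.Ico (-A) (B + k + 1), |(p (lam k l x) : ℝ)| := by
  have hA0 := mm_nonneg false (mv l)
  have hB0 := mm_nonneg true (mv l)
  rw [← hA] at hA0
  rw [← hB] at hB0
  have hp := pos_mm (mv l)
  rw [← hA, ← hB] at hp
  obtain ⟨N, hN⟩ := Int.eq_ofNat_of_zero_le (show 0 ≤ A + B + k + 1 by omega)
  have eN : -A + (N : ℤ) = B + k + 1 := by omega
  obtain ⟨m, hm, h1⟩ := LL_interval k (lam k l) A N
  have h2 := LL_mul h1 (LL_zpow k (pos (mv l) - (B + k + 1)))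
  rw [eN] at h2 hm
  have e : (⟨fun x => if x ∈ Finset.Ico (-A) (B + k + 1) then lam k l x else 1,
        Multiplicative.ofAdd (B + k + 1)⟩ : G) * tauG 0 ^ (pos (mv l) - (B + k + 1)) = Z k l := by
    apply SemidirectProduct.ext
    · funext x
      rw [left_mul, Z_left, tau_pow]
      simp only [Finset.mem_Ico, Pi.one_apply, mul_one]
      split_ifs with h
      · rfl
      · rw [lam_supp]; omega
    · rw [SemidirectProduct.mul_right, Z_right, tau_pow, ← ofAdd_add]
      congr 1; ring
  rw [e] at h2
  have h3 : lengthWrt (swsSet k 0) (Z k l) ≤ m + (pos (mv l) - (B + k + 1)).natAbs := Nat.sInf_le h2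
  have h4 : ((lengthWrt (swsSet k 0) (Z k l) : ℕ) : ℤ) ≤ 3 * (A + B + k + 1) +
      (2 * k + 2) * ∑ x ∈ Finset.Ico (-A) (B + k + 1), |p (lam k l x)| := by
    rw [abs_of_nonneg hA0] at hm
    generalize (2 * (k : ℤ) + 2) * ∑ x ∈ Finset.Ico (-A) (B + k + 1), |p (lam k l x)| = T at *
    omega
  exact_mod_cast h4

lemma E_psi (k n : ℕ) (ψ : D → ℝ) (y : ℤ) :
    Av Step n (fun l => ψ (lam k l y)) = Av Bool n (fun η => op (W k η y) ψ 1) := by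
  rw [← op_lam]; simp

lemma E_two_le (k n : ℕ) (S : Finset ℤ) :
    ∑ y ∈ S, Av Step n (fun l => (p (lam k l y) : ℝ) ^ 2) ≤ 4 * n := by
  have h1 : ∀ y, Av Step n (fun l => (p (lam k l y) : ℝ) ^ 2) ≤
      Av Bool n (fun η => ((W k η y).length : ℝ)) := by
    intro y
    rw [E_psi k n (fun v => (p v : ℝ) ^ 2) y]
    exact Av_mono _ _ _ fun η _ => op_sq_le _
  refine (Finset.sum_le_sum fun y _ => h1 y).trans ?_
  rw [← Av_sum]
  have h2 := Av_mono n (fun η => ∑ y ∈ S, ((W k η y).length : ℝ)) (fun _ => 4 * (n : ℝ))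
    (fun η hη => by rw [← hη]; exact sum_W_le k η S)
  rwa [Av_const] at h2

lemma E_four_le (k n : ℕ) (S : Finset ℤ) :
    ∑ y ∈ S, Av Step n (fun l => (p (lam k l y) : ℝ) ^ 4) ≤ 3 * (n * (32 * √n + 32)) := by
  have h1 : ∀ y, Av Step n (fun l => (p (lam k l y) : ℝ) ^ 4) ≤
      3 * Av Bool n (fun η => ((W k η y).length : ℝ) ^ 2) := by
    intro y
    rw [E_psi k n (fun v => (p v : ℝ) ^ 4) y, ← Av_mul]
    exact Av_mono _ _ _ fun η _ => op_four_le _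
  refine (Finset.sum_le_sum fun y _ => h1 y).trans ?_
  rw [← Finset.mul_sum]
  have := sum_W_sq k n S
  linarith

lemma E_two_ge (k n : ℕ) (hn : 1 ≤ n) (S : Finset ℤ) (hS : S = Finset.Icc (-(n : ℤ)) n) :
    (1 / 2 : ℝ) ^ (k + 1) / (k + 1) * n ≤ ∑ y ∈ S, Av Step n (fun l => (p (lam k l y) : ℝ) ^ 2) := by
  have h0S : (0 : ℤ) ∈ S := by rw [hS, Finset.mem_Icc]; omega
  have h1 : ∀ y, Av Bool n (fun η => (alt (W k η y) : ℝ) + if y = 0 then 1 / 2 else 0) ≤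
      Av Step n (fun l => (p (lam k l y) : ℝ) ^ 2) := by
    intro y
    rw [E_psi k n (fun v => (p v : ℝ) ^ 2) y]
    apply Av_mono
    intro η hη
    split_ifs with h
    · apply op_sq_ge'
      cases η with
      | nil => simp at hη; omega
      | cons e η => simp [W, ow, h]
    · rw [add_zero]; exact op_sq_ge _
  refine le_trans ?_ (Finset.sum_le_sum fun y _ => h1 y)
  simp only [Av_add, Av_const, Finset.sum_add_distrib]
  rw [← Av_sum, Finset.sum_ite_eq', if_pos h0S]
  set m := n / (k + 1) with hm
  have e : n = m * (k + 1) + n % (k + 1) := by rw [hm, mul_comm]; exact (Nat.div_add_mod _ _).symm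
  have h2 := alt_lower k m (n % (k + 1)) S (by rw [← e, hS])
  rw [← e] at h2
  have h3 : n < (m + 1) * (k + 1) := by
    have : n % (k + 1) < k + 1 := Nat.mod_lt n (Nat.succ_pos k)
    rw [add_mul]; omega
  have h4 : (n : ℝ) / (k + 1) ≤ m + 1 := by
    rw [div_le_iff₀ (by positivity)]
    exact_mod_cast h3.le
  have h5 : (1 / 2 : ℝ) ^ (k + 1) ≤ 1 / 2 := by
    calc (1 / 2 : ℝ) ^ (k + 1) ≤ (1 / 2) ^ 1 :=
          pow_le_pow_of_le_one (by norm_num) (by norm_num) (by omega)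
      _ = 1 / 2 := by norm_num
  have h6 : 0 < (1 / 2 : ℝ) ^ (k + 1) := by positivity
  have h7 : (1 / 2 : ℝ) ^ (k + 1) / (k + 1) * n = (1 / 2 : ℝ) ^ (k + 1) * (n / (k + 1)) := by ring
  rw [h7]
  have h8 : (1 / 2 : ℝ) ^ (k + 1) * (n / (k + 1)) ≤ (1 / 2 : ℝ) ^ (k + 1) * (m + 1) := by gcongr
  linarith

lemma upper (k n : ℕ) (hn : 1 ≤ n) (s : ℝ) (hs : 1 ≤ s) (hs4 : s ^ 4 = n) (hs2 : √(n : ℝ) = s ^ 2) :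
    walkE k 0 n ≤ ((k + 4) * (k + 3) + 4 * (k + 1)) * s ^ 3 := by
  rw [walkE_eq]
  have hs0 : 0 < s := by linarith
  set S : Finset ℤ := Finset.Ico (-(n : ℤ)) (n + k + 1) with hS
  have hpt : Av Step n (fun l => (lengthWrt (swsSet k 0) (Z k l) : ℝ)) ≤
      Av Step n (fun l => (3 + (k + 1) * s) * (mm false (mv l) : ℝ) +
        ((3 + (k + 1) * s) * (mm true (mv l) : ℝ) + ((3 + (k + 1) * s) * (k + 1) +
        (k + 1) / s * ∑ x ∈ S, (p (lam k l x) : ℝ) ^ 2))) := by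
    apply Av_mono
    intro l hl
    set A := mm false (mv l) with hA
    set B := mm true (mv l) with hB
    have hA0 : 0 ≤ A := mm_nonneg _ _
    have hB0 : 0 ≤ B := mm_nonneg _ _
    have hA1 : A ≤ n := by have := mm_le false (mv l); simpa [mv, hl] using this
    have hB1 : B ≤ n := by have := mm_le true (mv l); simpa [mv, hl] using this
    refine (length_upper k l A B hA hB).trans ?_
    have hx : ∀ x ∈ Finset.Ico (-A) (B + k + 1), |(p (lam k l x) : ℝ)| ≤
        s / 2 + 1 / (2 * s) * (p (lam k l x) : ℝ) ^ 2 := by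
      intro x _
      rw [← sq_abs (p (lam k l x) : ℝ)]
      set z := |(p (lam k l x) : ℝ)|
      have e : s / 2 + 1 / (2 * s) * z ^ 2 - z = (z - s) ^ 2 / (2 * s) := by field_simp; ring
      have : 0 ≤ (z - s) ^ 2 / (2 * s) := by positivity
      linarith
    have h1 := Finset.sum_le_sum hx
    rw [Finset.sum_add_distrib, ← Finset.mul_sum, Finset.sum_const, Int.card_Ico, nsmul_eq_mul] at h1
    have h2 : (((B + k + 1 - -A).toNat : ℕ) : ℝ) = A + B + k + 1 := by
      have : (((B + k + 1 - -A).toNat : ℕ) : ℤ) = A + B + k + 1 := by omega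
      exact_mod_cast this
    rw [h2] at h1
    have h3 : ∑ x ∈ Finset.Ico (-A) (B + k + 1), (p (lam k l x) : ℝ) ^ 2 ≤
        ∑ x ∈ S, (p (lam k l x) : ℝ) ^ 2 := by
      apply Finset.sum_le_sum_of_subset_of_nonneg
      · rw [hS]; apply Finset.Ico_subset_Ico <;> omega
      · intros; positivity
    have h4 : 1 / (2 * s) * ∑ x ∈ Finset.Ico (-A) (B + k + 1), (p (lam k l x) : ℝ) ^ 2 ≤
        1 / (2 * s) * ∑ x ∈ S, (p (lam k l x) : ℝ) ^ 2 := by gcongr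
    have h5 : (2 * (k : ℝ) + 2) * ∑ x ∈ Finset.Ico (-A) (B + k + 1), |(p (lam k l x) : ℝ)| ≤
        (2 * k + 2) * ((A + B + k + 1) * (s / 2) +
          1 / (2 * s) * ∑ x ∈ S, (p (lam k l x) : ℝ) ^ 2) := by
      gcongr; linarith
    have h6 : (2 * (k : ℝ) + 2) * ((A + B + k + 1) * (s / 2) +
          1 / (2 * s) * ∑ x ∈ S, (p (lam k l x) : ℝ) ^ 2) = (k + 1) * s * (A + B + k + 1) +
          (k + 1) / s * ∑ x ∈ S, (p (lam k l x) : ℝ) ^ 2 := by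
      field_simp
    rw [h6] at h5
    linarith
  refine hpt.trans ?_
  rw [Av_add, Av_add, Av_add, Av_mul, Av_mul, Av_const, Av_mul, Av_sum,
    Av_map n (fun η => (mm false η : ℝ)), Av_map n (fun η => (mm true η : ℝ))]
  have a1 := Av_mm false n hn
  have a2 := Av_mm true n hn
  have a3 := E_two_le k n S
  rw [hs2] at a1 a2
  rw [← hs4] at a3
  have b1 : (3 + (k + 1) * s) * Av Bool n (fun η => (mm false η : ℝ)) ≤ (3 + (k + 1) * s) * s ^ 2 := by
    gcongr
  have b2 : (3 + (k + 1) * s) * Av Bool n (fun η => (mm true η : ℝ)) ≤ (3 + (k + 1) * s) * s ^ 2 := by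
    gcongr
  have b3 : ((k : ℝ) + 1) / s * ∑ y ∈ S, Av Step n (fun l => (p (lam k l y) : ℝ) ^ 2) ≤
      (k + 1) / s * (4 * s ^ 4) := by gcongr
  have b4 : ((k : ℝ) + 1) / s * (4 * s ^ 4) = 4 * (k + 1) * s ^ 3 := by field_simp
  have hk : (0 : ℝ) ≤ k := by positivity
  have b5 : (3 + ((k : ℝ) + 1) * s) ≤ (k + 4) * s := by nlinarith
  have b6 : (2 * s ^ 2 + ((k : ℝ) + 1)) ≤ (k + 3) * s ^ 2 := by
    have hq : 1 ≤ s ^ 2 := one_le_pow₀ hs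
    nlinarith
  have b7 : (3 + ((k : ℝ) + 1) * s) * (2 * s ^ 2 + ((k : ℝ) + 1)) ≤
      ((k + 4) * s) * ((k + 3) * s ^ 2) := by gcongr
  nlinarith

lemma lower (k n : ℕ) (hn : 1 ≤ n) (s : ℝ) (hs : 1 ≤ s) (hs4 : s ^ 4 = n) (hs2 : √(n : ℝ) = s ^ 2)
    (c : ℝ) (hc : c = (1 / 2 : ℝ) ^ (k + 1) / (k + 1)) :
    c ^ 2 / 3072 * s ^ 3 ≤ walkE k 0 n := by
  rw [walkE_eq]
  have hs0 : 0 < s := by linarith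
  have hc0 : 0 < c := by rw [hc]; positivity
  have hc1 : c ≤ 1 := by
    rw [hc, div_le_one (by positivity)]
    have : (1 / 2 : ℝ) ^ (k + 1) ≤ 1 := pow_le_one₀ (by norm_num) (by norm_num)
    have hk : (0 : ℝ) ≤ k := by positivity
    linarith
  set S : Finset ℤ := Finset.Icc (-(n : ℤ)) n with hS
  set M : ℝ := 384 / c with hM
  have hM1 : 1 ≤ M := by rw [hM, le_div_iff₀ hc0]; linarith
  have hM0 : 0 < M := by linarith
  have hMc : M * c = 384 := by rw [hM]; field_simp
  set t := M * s with ht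
  have ht0 : 0 < t := by positivity
  have h2 := E_two_ge k n hn S hS
  have h4 := E_four_le k n S
  rw [← hc, ← hs4] at h2
  rw [hs2, ← hs4] at h4
  have h1 : Av Step n (fun l => ∑ x ∈ S, |(p (lam k l x) : ℝ)|) ≤
      4 * Av Step n (fun l => (lengthWrt (swsSet k 0) (Z k l) : ℝ)) := by
    rw [← Av_mul]
    exact Av_mono _ _ _ fun l _ => length_lower k S l
  rw [Av_sum] at h1
  have hpt : ∀ y, Av Step n (fun l => (p (lam k l y) : ℝ) ^ 2) ≤
      t * Av Step n (fun l => |(p (lam k l y) : ℝ)|) +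
      1 / t ^ 2 * Av Step n (fun l => (p (lam k l y) : ℝ) ^ 4) := by
    intro y
    rw [← Av_mul, ← Av_mul, ← Av_add]
    apply Av_mono
    intro l _
    have e4 : (p (lam k l y) : ℝ) ^ 4 = |(p (lam k l y) : ℝ)| ^ 4 := by
      rw [← abs_pow, abs_of_nonneg (by positivity)]
    rw [← sq_abs, e4]
    have hz : 0 ≤ |(p (lam k l y) : ℝ)| := abs_nonneg _
    generalize |(p (lam k l y) : ℝ)| = z at *
    rcases le_total z t with h | h
    · have : 0 ≤ 1 / t ^ 2 * z ^ 4 := by positivity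
      nlinarith
    · have h5 : z ^ 2 ≤ 1 / t ^ 2 * z ^ 4 := by
        rw [one_div, ← div_eq_inv_mul, le_div_iff₀ (by positivity)]
        have : t ^ 2 ≤ z ^ 2 := by gcongr
        nlinarith [sq_nonneg z]
      have : 0 ≤ t * z := by positivity
      linarith
  have h3 := Finset.sum_le_sum (s := S) fun y _ => hpt y
  rw [Finset.sum_add_distrib, ← Finset.mul_sum, ← Finset.mul_sum] at h3
  have h5 : 3 * (s ^ 4 * (32 * s ^ 2 + 32)) ≤ 192 * s ^ 6 := by
    have : s ^ 4 * 1 ≤ s ^ 4 * s ^ 2 := by gcongr; nlinarith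
    nlinarith
  have h6 : 1 / t ^ 2 * ∑ y ∈ S, Av Step n (fun l => (p (lam k l y) : ℝ) ^ 4) ≤
      1 / t ^ 2 * (192 * s ^ 6) := by gcongr; linarith
  have h7 : 1 / t ^ 2 * (192 * s ^ 6) = 192 / M ^ 2 * s ^ 4 := by rw [ht]; field_simp
  have h8 : 192 / M ^ 2 ≤ c / 2 := by
    rw [div_le_iff₀ (by positivity)]
    nlinarith
  have h9 : 192 / M ^ 2 * s ^ 4 ≤ c / 2 * s ^ 4 := by gcongr
  have h10 : t * ∑ y ∈ S, Av Step n (fun l => |(p (lam k l y) : ℝ)|) ≤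
      t * (4 * Av Step n (fun l => (lengthWrt (swsSet k 0) (Z k l) : ℝ))) := by gcongr
  generalize Av Step n (fun l => (lengthWrt (swsSet k 0) (Z k l) : ℝ)) = E at *
  have h11 : c / 2 * s ^ 4 ≤ t * (4 * E) := by linarith
  have h12 : t * (4 * (c ^ 2 / 3072 * s ^ 3)) = c / 2 * s ^ 4 := by
    rw [ht, hM]; field_simp; norm_num
  rw [← h12] at h11
  have h13 := le_of_mul_le_mul_left h11 ht0
  linarith

end Pf

/-- For the switch-walk-switch random walk on `ℤ ≀ D_∞` (infinite dihedral lamps,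
encoded by `DihedralGroup 0`, shift parameter `k`), there are constants
`c₁, c₂ > 0` depending only on `k` with `c₁ n^{3/4} ≤ E|Z_n| ≤ c₂ n^{3/4}`. -/
theorem stmt18 (k : ℕ) : ∃ c₁ c₂ : ℝ, 0 < c₁ ∧ 0 < c₂ ∧ ∀ n : ℕ, 1 ≤ n →
    c₁ * (n : ℝ) ^ ((3 : ℝ) / 4) ≤ walkE k 0 n ∧
    walkE k 0 n ≤ c₂ * (n : ℝ) ^ ((3 : ℝ) / 4) := by
  refine ⟨((1 / 2 : ℝ) ^ (k + 1) / (k + 1)) ^ 2 / 3072, (k + 4) * (k + 3) + 4 * (k + 1),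
    by positivity, by positivity, ?_⟩
  intro n hn
  have hn0 : (0 : ℝ) ≤ n := by positivity
  set s : ℝ := (n : ℝ) ^ ((1 : ℝ) / 4) with hs
  have hs1 : 1 ≤ s := Real.one_le_rpow (by exact_mod_cast hn) (by norm_num)
  have hs4 : s ^ 4 = n := by
    rw [hs, ← Real.rpow_natCast, ← Real.rpow_mul hn0]; norm_num
  have hs2 : √(n : ℝ) = s ^ 2 := by
    rw [← hs4, show s ^ 4 = (s ^ 2) ^ 2 by ring, Real.sqrt_sq (by positivity)]
  have hs3 : (n : ℝ) ^ ((3 : ℝ) / 4) = s ^ 3 := by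
    rw [hs, ← Real.rpow_natCast, ← Real.rpow_mul hn0]; norm_num
  rw [hs3]
  exact ⟨Pf.lower k n hn s hs1 hs4 hs2 _ rfl, Pf.upper k n hn s hs1 hs4 hs2⟩
end
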